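/- Let f be a piecewise contracting interval map on X which is piecewise monotonic and satisfies D ⊂ X̃. Then there exist natural numbers N₁, N₂ ≥ 0 with N₁ + N₂ ≥ 1 such that the attractor Λ of f decomposes as Λ = (∪_{i=1}^{N₁} 𝒪_i) ∪ (∪_{j=1}^{N₂} K_j), where 𝒪_1,…,𝒪_{N₁} ⊂ X̃ are pairwise disjoint periodic orbits of f and K_1,…,K_{N₂} are pairwise distinct f-pseudo-invariant, X̃-minimal Cantor sets (non-empty compact, perfect, totally disconnected subsets of X). Moreover, for every x ∈ X̃, either ω(x) = 𝒪_i for some i ∈ {1,…,N₁} or ω(x) = K_j for some j ∈ {1,…,N₂}, where ω(x) denotes the ω-limit set of x under f. -/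

import Mathlib

open Set Filter Metric Topology

/-- A piecewise contracting interval map (PCIM) on the compact interval `X = [a,b]`:
there are `N ≥ 1` pairwise disjoint nonempty open (relative to `X`) subintervals
whose closures cover `X`, and `f` contracts with rate `lam ∈ (0,1)` on each piece. -/
structure PCIM where
  a : ℝ
  b : ℝ
  hab : a < b
  N : ℕ
  hN : 1 ≤ N
  f : ℝ → ℝ
  lam : ℝ
  hlam₀ : 0 < lam
  hlam₁ : lam < 1
  piece : Fin N → Set ℝ
  piece_nonempty : ∀ i, (piece i).Nonempty
  piece_interval : ∀ i, ∃ c d : ℝ, piece i = Set.Ioo c d ∩ Set.Icc a b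
  piece_disjoint : ∀ i j, i ≠ j → Disjoint (piece i) (piece j)
  cover : Set.Icc a b = ⋃ i, closure (piece i)
  mapsTo : Set.MapsTo f (Set.Icc a b) (Set.Icc a b)
  contract : ∀ i, ∀ x ∈ piece i, ∀ y ∈ piece i, |f x - f y| ≤ lam * |x - y|

namespace PCIM

variable (P : PCIM)

/-- The underlying compact interval `X`. -/
def X : Set ℝ := Set.Icc P.a P.b

/-- `X* = ⋃ i, X_i`, the union of the contraction pieces. -/
def Xstar : Set ℝ := ⋃ i, P.piece i

/-- `Δ = X \ X*`, the set of boundaries of the contraction pieces. -/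
def Delta : Set ℝ := P.X \ P.Xstar

/-- `X̃ = ⋂_{j ≥ 0} f⁻ʲ(X*)`, the points all of whose iterates are well defined. -/
def Xtilde : Set ℝ := ⋂ j : ℕ, (P.f^[j]) ⁻¹' P.Xstar

/-- `D`: the set of one-sided limits of `f` at the points of `Δ`. -/
def D : Set ℝ :=
  {L | ∃ c ∈ P.Delta,
    ((𝓝[P.X ∩ Set.Iio c] c).NeBot ∧ Filter.Tendsto P.f (𝓝[P.X ∩ Set.Iio c] c) (𝓝 L)) ∨
    ((𝓝[P.X ∩ Set.Ioi c] c).NeBot ∧ Filter.Tendsto P.f (𝓝[P.X ∩ Set.Ioi c] c) (𝓝 L))}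

/-- A set `A` is `f`-pseudo-invariant if for every `x ∈ A` at least one of the
one-sided limits of `f` at `x` belongs to `A`. -/
def PseudoInvariant (A : Set ℝ) : Prop :=
  ∀ x ∈ A,
    (∃ L ∈ A, (𝓝[P.X ∩ Set.Iio x] x).NeBot ∧
      Filter.Tendsto P.f (𝓝[P.X ∩ Set.Iio x] x) (𝓝 L)) ∨
    (∃ L ∈ A, (𝓝[P.X ∩ Set.Ioi x] x).NeBot ∧
      Filter.Tendsto P.f (𝓝[P.X ∩ Set.Ioi x] x) (𝓝 L))

/-- `f` is piecewise monotonic: strictly monotone on each contraction piece. -/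
def PiecewiseMonotonic : Prop :=
  ∀ i, StrictMonoOn P.f (P.piece i) ∨ StrictAntiOn P.f (P.piece i)

/-- `f` satisfies the separation property: it is piecewise monotonic and the closures
of the images of distinct pieces are disjoint. -/
def SeparationProperty : Prop :=
  P.PiecewiseMonotonic ∧
    ∀ i j, i ≠ j → closure (P.f '' P.piece i) ∩ closure (P.f '' P.piece j) = ∅

/-- The iterates `Λ_n` defining the attractor: `Λ_0 = X`,
`Λ_{n+1} = cl (f (Λ_n \ Δ))`. -/
def LambdaIter : (P : PCIM) → ℕ → Set ℝ
  | Q, 0 => Q.X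
  | Q, n + 1 => closure (Q.f '' (LambdaIter Q n \ Q.Delta))

/-- The attractor `Λ = ⋂_{n ≥ 1} Λ_n`. -/
def Lambda : Set ℝ := ⋂ n : ℕ, P.LambdaIter (n + 1)

/-- The atom associated to the word `w = [i₁, …, iₙ]`:
`A_{i₁…iₙ} = F_{iₙ} ∘ ⋯ ∘ F_{i₁}(X)` where `F_i(A) = cl (f (A ∩ X_i))`. -/
def atomOf (w : List (Fin P.N)) : Set ℝ :=
  w.foldl (fun A i => closure (P.f '' (A ∩ P.piece i))) P.X

/-- `𝒜_n`: the set of (nonempty) atoms of generation `n`. -/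
def atoms (n : ℕ) : Set (Set ℝ) :=
  {A | ∃ w : List (Fin P.N), w.length = n ∧ P.atomOf w = A ∧ A.Nonempty}

/-- `θ` is the itinerary of `x`: `f^t(x) ∈ X_{θ_t}` for all `t`. -/
def IsItinerary (x : ℝ) (θ : ℕ → Fin P.N) : Prop :=
  ∀ t : ℕ, P.f^[t] x ∈ P.piece (θ t)

/-- The word `θ_t θ_{t+1} … θ_{t+n-1}` of length `n` of the sequence `θ`. -/
def word (θ : ℕ → Fin P.N) (t n : ℕ) : List (Fin P.N) :=
  (List.range n).map fun k => θ (t + k)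

/-- `L_n(θ)`: the set of words of length `n` occurring in `θ`. -/
def lang (θ : ℕ → Fin P.N) (n : ℕ) : Set (List (Fin P.N)) :=
  {w | ∃ t : ℕ, w = P.word θ t n}

/-- The complexity function `p_θ(n) = #L_n(θ)`. -/
noncomputable def complexity (θ : ℕ → Fin P.N) (n : ℕ) : ℕ := (P.lang θ n).ncard

/-- The forward orbit of `x` under `f`. -/
def orbit (x : ℝ) : Set ℝ := {y | ∃ k : ℕ, P.f^[k] x = y}

/-- The ω-limit set of `x` under `f`. -/
def omegaLimitSet (x : ℝ) : Set ℝ :=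
  ⋂ n : ℕ, closure {y | ∃ m : ℕ, n ≤ m ∧ P.f^[m] x = y}

/-- A compact pseudo-invariant set `A` is `X̃`-minimal if the orbit of every point
of `A ∩ X̃` is dense in `A`. -/
def XtildeMinimal (A : Set ℝ) : Prop :=
  IsCompact A ∧ P.PseudoInvariant A ∧ ∀ x ∈ A ∩ P.Xtilde, A ⊆ closure (P.orbit x)

/-- A periodic orbit contained in `X̃`. -/
def IsPeriodicOrbit (A : Set ℝ) : Prop :=
  ∃ x ∈ P.Xtilde, ∃ p : ℕ, 1 ≤ p ∧ P.f^[p] x = x ∧ A = P.orbit x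

end PCIM

/-- A Cantor set: nonempty, compact, perfect and totally disconnected. -/
def IsCantorSet (A : Set ℝ) : Prop :=
  A.Nonempty ∧ IsCompact A ∧ Perfect A ∧ IsTotallyDisconnected A

theorem monotoneOn_Icc_of_Ioo {g : ℝ → ℝ} {l r : ℝ} (hlr : l < r) (hg : Continuous g)
    (h : MonotoneOn g (Ioo l r)) : MonotoneOn g (Icc l r) := by
  intro x hx y hy hxy
  have key : ∀ z : ℝ, Tendsto (fun t : ℝ => g (z + t * ((l + r) / 2 - z))) (𝓝[>] 0) (𝓝 (g z)) := by
    intro z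
    have : Continuous fun t : ℝ => g (z + t * ((l + r) / 2 - z)) := by fun_prop
    have h0 := this.tendsto 0
    simp only [zero_mul, add_zero] at h0
    exact h0.mono_left nhdsWithin_le_nhds
  have inside : ∀ z ∈ Icc l r, ∀ t ∈ Ioo (0 : ℝ) 1, z + t * ((l + r) / 2 - z) ∈ Ioo l r := by
    rintro z ⟨h1, h2⟩ t ⟨h3, h4⟩
    constructor <;> nlinarith
  refine le_of_tendsto_of_tendsto (key x) (key y) ?_
  filter_upwards [Ioo_mem_nhdsGT (zero_lt_one' ℝ)] with t ht
  refine h (inside x hx t ht) (inside y hy t ht) ?_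
  nlinarith [ht.1, ht.2]

namespace PCIM

variable (P : PCIM)

theorem piece_subset_X (i : Fin P.N) : P.piece i ⊆ P.X := by
  obtain ⟨c, d, h⟩ := P.piece_interval i
  rw [h]
  exact inter_subset_right

theorem closure_piece_subset_X (i : Fin P.N) : closure (P.piece i) ⊆ P.X :=
  closure_minimal (P.piece_subset_X i) isClosed_Icc

theorem exists_mem_closure_piece {x : ℝ} (hx : x ∈ P.X) : ∃ i, x ∈ closure (P.piece i) := by
  have : x ∈ ⋃ i, closure (P.piece i) := P.cover ▸ hx
  simpa using this

theorem Xstar_subset_X : P.Xstar ⊆ P.X := iUnion_subset P.piece_subset_X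

theorem exists_ball_inter_subset_piece {i : Fin P.N} {x : ℝ} (hx : x ∈ P.piece i) :
    ∃ ε > 0, ∀ y ∈ P.X, |y - x| < ε → y ∈ P.piece i := by
  obtain ⟨c, d, h⟩ := P.piece_interval i
  rw [h] at hx ⊢
  refine ⟨min (x - c) (d - x), lt_min (by linarith [hx.1.1]) (by linarith [hx.1.2]), ?_⟩
  intro y hy hyx
  rw [lt_min_iff, abs_lt, abs_lt] at hyx
  exact ⟨⟨by linarith [hyx.1.1], by linarith [hyx.2.2]⟩, hy⟩

theorem eq_of_mem_closure_of_mem {i j : Fin P.N} {x : ℝ} (hi : x ∈ closure (P.piece i))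
    (hj : x ∈ P.piece j) : i = j := by
  by_contra hij
  obtain ⟨ε, hε, h⟩ := P.exists_ball_inter_subset_piece hj
  obtain ⟨y, hy, hyx⟩ := Metric.mem_closure_iff.1 hi ε hε
  have := h y (P.piece_subset_X i hy) (by rwa [dist_comm, Real.dist_eq] at hyx)
  exact disjoint_left.1 (P.piece_disjoint i j hij) hy this

theorem mem_Delta_of_mem_closure {i : Fin P.N} {x : ℝ} (hx : x ∈ closure (P.piece i))
    (hx' : x ∉ P.piece i) : x ∈ P.Delta := by
  refine ⟨P.closure_piece_subset_X i hx, fun h => ?_⟩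
  obtain ⟨j, hj⟩ := mem_iUnion.1 h
  exact hx' (P.eq_of_mem_closure_of_mem hx hj ▸ hj)

theorem notMem_piece_of_mem_Delta {c : ℝ} (hc : c ∈ P.Delta) (i : Fin P.N) : c ∉ P.piece i :=
  fun h => hc.2 (mem_iUnion.2 ⟨i, h⟩)

theorem exists_endpoints (i : Fin P.N) : ∃ l r, l < r ∧ closure (P.piece i) = Icc l r ∧
    Ioo l r ⊆ P.piece i ∧ (∀ x ∈ P.X, x < l → l ∈ P.Delta) ∧
    (∀ x ∈ P.X, r < x → r ∈ P.Delta) := by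
  obtain ⟨c, d, h⟩ := P.piece_interval i
  have hab := P.hab
  obtain ⟨z, hz⟩ := P.piece_nonempty i
  rw [h] at hz
  have hlr : max c P.a < min d P.b := by
    obtain ⟨⟨h1, h2⟩, h3, h4⟩ := hz
    rcases lt_or_ge P.a z with ha | ha
    · exact (max_lt h1 ha).trans_le (le_min h2.le h4)
    · exact (max_le h1.le h3).trans_lt (lt_min h2 (by linarith))
  have hsub : Ioo (max c P.a) (min d P.b) ⊆ P.piece i := by
    rintro y ⟨h1, h2⟩
    rw [max_lt_iff] at h1
    rw [lt_min_iff] at h2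
    rw [h]
    exact ⟨⟨h1.1, h2.1⟩, h1.2.le, h2.2.le⟩
  have hsub' : P.piece i ⊆ Icc (max c P.a) (min d P.b) := by
    rw [h]
    rintro y ⟨⟨h1, h2⟩, h3, h4⟩
    exact ⟨max_le h1.le h3, le_min h2.le h4⟩
  have hcl : closure (P.piece i) = Icc (max c P.a) (min d P.b) := by
    apply Subset.antisymm (closure_minimal hsub' isClosed_Icc)
    rw [← closure_Ioo hlr.ne]
    exact closure_mono hsub
  refine ⟨_, _, hlr, hcl, hsub, fun x hx hxl => ?_, fun x hx hxr => ?_⟩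
  · refine P.mem_Delta_of_mem_closure (hcl ▸ left_mem_Icc.2 hlr.le) fun hm => ?_
    rw [h] at hm
    have h1 := hm.1.1
    have h2 := hx.1
    rcases max_cases c P.a with h3 | h3 <;> linarith
  · refine P.mem_Delta_of_mem_closure (hcl ▸ right_mem_Icc.2 hlr.le) fun hm => ?_
    rw [h] at hm
    have h1 := hm.1.2
    have h2 := hx.2
    rcases min_cases d P.b with h3 | h3 <;> linarith

theorem finite_Delta : P.Delta.Finite := by
  choose l r _ hcl hsub _ _ using P.exists_endpoints
  refine (finite_iUnion fun i => (finite_insert (a := l i)).2 (finite_singleton (r i))).subset ?_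
  intro c hc
  obtain ⟨i, hi⟩ := P.exists_mem_closure_piece hc.1
  have hn := P.notMem_piece_of_mem_Delta hc i
  rw [hcl i] at hi
  refine mem_iUnion.2 ⟨i, ?_⟩
  rcases hi.1.eq_or_lt with h1 | h1
  · exact Or.inl h1.symm
  rcases hi.2.eq_or_lt with h2 | h2
  · exact Or.inr h2
  exact absurd (hsub i ⟨h1, h2⟩) hn

theorem exists_mem_Delta_between {i : Fin P.N} {p w : ℝ} (hp : p ∈ P.piece i) (hw : w ∈ P.X)
    (hwi : w ∉ P.piece i) : ∃ c ∈ P.Delta, c ∈ closure (P.piece i) ∧ |p - c| ≤ |p - w| := by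
  obtain ⟨l, r, hlr, hcl, hsub, hl, hr⟩ := P.exists_endpoints i
  by_cases hw' : w ∈ closure (P.piece i)
  · exact ⟨w, P.mem_Delta_of_mem_closure hw' hwi, hw', le_rfl⟩
  have hp' : p ∈ Icc l r := hcl ▸ subset_closure hp
  rw [hcl, mem_Icc, not_and_or, not_le, not_le] at hw'
  rcases hw' with h | h
  · refine ⟨l, hl w hw h, hcl ▸ left_mem_Icc.2 hlr.le, ?_⟩
    rw [abs_of_nonneg (by linarith [hp'.1]), abs_of_nonneg (by linarith [hp'.1])]
    linarith
  · refine ⟨r, hr w hw h, hcl ▸ right_mem_Icc.2 hlr.le, ?_⟩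
    rw [abs_of_nonpos (by linarith [hp'.2]), abs_of_nonpos (by linarith [hp'.2])]
    linarith

theorem exists_lipschitz_extension (i : Fin P.N) :
    ∃ g : ℝ → ℝ, LipschitzWith (Real.toNNReal P.lam) g ∧ EqOn P.f g (P.piece i) := by
  apply LipschitzOnWith.extend_real
  refine LipschitzOnWith.of_dist_le_mul fun x hx y hy => ?_
  rw [Real.coe_toNNReal _ P.hlam₀.le, Real.dist_eq, Real.dist_eq]
  exact P.contract i x hx y hy

/-- A contracting extension to `ℝ` of the restriction of `f` to the `i`-th piece. -/
noncomputable def branch (i : Fin P.N) : ℝ → ℝ := (P.exists_lipschitz_extension i).choose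

theorem branch_lipschitz (i : Fin P.N) : LipschitzWith (Real.toNNReal P.lam) (P.branch i) :=
  (P.exists_lipschitz_extension i).choose_spec.1

theorem branch_eq {i : Fin P.N} {x : ℝ} (hx : x ∈ P.piece i) : P.branch i x = P.f x :=
  ((P.exists_lipschitz_extension i).choose_spec.2 hx).symm

theorem abs_branch_sub_le (i : Fin P.N) (x y : ℝ) :
    |P.branch i x - P.branch i y| ≤ P.lam * |x - y| := by
  have := (P.branch_lipschitz i).dist_le_mul x y
  rwa [Real.coe_toNNReal _ P.hlam₀.le, Real.dist_eq, Real.dist_eq] at this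

theorem branch_monotoneOn_or_antitoneOn (hmono : P.PiecewiseMonotonic) (i : Fin P.N) :
    MonotoneOn (P.branch i) (closure (P.piece i)) ∨
      AntitoneOn (P.branch i) (closure (P.piece i)) := by
  obtain ⟨l, r, hlr, hcl, hsub, -, -⟩ := P.exists_endpoints i
  have hc := (P.branch_lipschitz i).continuous
  rw [hcl]
  rcases hmono i with h | h
  · left
    refine monotoneOn_Icc_of_Ioo hlr hc fun x hx y hy hxy => ?_
    rw [P.branch_eq (hsub hx), P.branch_eq (hsub hy)]
    exact h.monotoneOn (hsub hx) (hsub hy) hxy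
  · right
    have := monotoneOn_Icc_of_Ioo hlr hc.neg fun x hx y hy hxy => by
      rw [Pi.neg_apply, Pi.neg_apply, P.branch_eq (hsub hx), P.branch_eq (hsub hy)]
      exact neg_le_neg (h.antitoneOn (hsub hx) (hsub hy) hxy)
    exact fun x hx y hy hxy => neg_le_neg_iff.1 (this hx hy hxy)

theorem branch_isOneSidedLimit {i : Fin P.N} {x : ℝ} (hx : x ∈ closure (P.piece i)) :
    ((𝓝[P.X ∩ Iio x] x).NeBot ∧ Tendsto P.f (𝓝[P.X ∩ Iio x] x) (𝓝 (P.branch i x))) ∨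
    ((𝓝[P.X ∩ Ioi x] x).NeBot ∧ Tendsto P.f (𝓝[P.X ∩ Ioi x] x) (𝓝 (P.branch i x))) := by
  obtain ⟨l, r, hlr, hcl, hsub, -, -⟩ := P.exists_endpoints i
  have hX : Ioo l r ⊆ P.X := hsub.trans (P.piece_subset_X i)
  rw [hcl] at hx
  have hc : ∀ s, Tendsto (P.branch i) (𝓝[s] x) (𝓝 (P.branch i x)) := fun s =>
    (P.branch_lipschitz i).continuous.continuousWithinAt
  rcases hx.2.lt_or_eq with h | h
  · right
    constructor
    · refine (left_nhdsWithin_Ioo_neBot h).mono ?_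
      exact nhdsWithin_mono _ fun y hy => ⟨hX ⟨hx.1.trans_lt hy.1, hy.2⟩, hy.1⟩
    · refine (hc _).congr' ?_
      filter_upwards [self_mem_nhdsWithin, mem_nhdsWithin_of_mem_nhds (Iio_mem_nhds h)] with y h1 h2
      exact P.branch_eq (hsub ⟨hx.1.trans_lt h1.2, h2⟩)
  · left
    have h : l < x := h ▸ hlr
    constructor
    · refine (right_nhdsWithin_Ioo_neBot h).mono ?_
      exact nhdsWithin_mono _ fun y hy => ⟨hX ⟨hy.1, hy.2.trans_le hx.2⟩, hy.2⟩
    · refine (hc _).congr' ?_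
      filter_upwards [self_mem_nhdsWithin, mem_nhdsWithin_of_mem_nhds (Ioi_mem_nhds h)] with y h1 h2
      exact P.branch_eq (hsub ⟨h2, lt_of_lt_of_le h1.2 hx.2⟩)

theorem branch_mem_D {i : Fin P.N} {c : ℝ} (hc : c ∈ P.Delta) (hx : c ∈ closure (P.piece i)) :
    P.branch i c ∈ P.D :=
  ⟨c, hc, P.branch_isOneSidedLimit hx⟩

/-- `v` is the value at `u` of the continuous extension of `f` from some piece adherent to `u`. -/
def Step (u v : ℝ) : Prop := ∃ i, u ∈ closure (P.piece i) ∧ P.branch i u = v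

/-- `v` is reached from `u` by `n` consecutive steps. -/
def Reach (P : PCIM) : ℕ → ℝ → ℝ → Prop
  | 0, u, v => u = v
  | n + 1, u, v => ∃ w, Reach P n u w ∧ P.Step w v

/-- The sequence `u` accumulates at the boundary point `c` from inside the `i`-th piece. -/
def Accumulates (u : ℕ → ℝ) (c : ℝ) (i : Fin P.N) : Prop :=
  c ∈ P.Delta ∧ ∀ ε > 0, ∀ n, ∃ m ≥ n, u m ∈ P.piece i ∧ |u m - c| < ε

/-- The trajectory of `x` under `f`. -/
def traj (x : ℝ) (n : ℕ) : ℝ := P.f^[n] x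

/-- The sequence `u` is asymptotically closed under taking `k` steps, for every `k`. -/
def Shifting (u : ℕ → ℝ) : Prop :=
  ∀ k n, ∃ N, ∀ m ≥ N, ∃ m' ≥ n, P.Reach k (u m) (u m')

variable {P}

theorem Step.eq_branch {i : Fin P.N} {u v : ℝ} (h : P.Step u v) (hu : u ∈ P.piece i) :
    v = P.branch i u := by
  obtain ⟨j, hj, rfl⟩ := h
  rw [P.eq_of_mem_closure_of_mem hj hu]

theorem Step.eq_of_mem_Xstar {u v : ℝ} (h : P.Step u v) (hu : u ∈ P.Xstar) : v = P.f u := by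
  obtain ⟨i, hi⟩ := mem_iUnion.1 hu
  rw [h.eq_branch hi, P.branch_eq hi]

theorem step_of_mem_Xstar {u : ℝ} (hu : u ∈ P.Xstar) : P.Step u (P.f u) := by
  obtain ⟨i, hi⟩ := mem_iUnion.1 hu
  exact ⟨i, subset_closure hi, P.branch_eq hi⟩

theorem reach_one {u v : ℝ} : P.Reach 1 u v ↔ P.Step u v :=
  ⟨fun ⟨_, h, h'⟩ => (show u = _ from h) ▸ h', fun h => ⟨u, rfl, h⟩⟩

theorem Reach.cons {n : ℕ} {u w v : ℝ} (h : P.Step u w) (h' : P.Reach n w v) :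
    P.Reach (n + 1) u v := by
  induction n generalizing v with
  | zero => exact (show w = v from h') ▸ reach_one.2 h
  | succ n ih =>
    obtain ⟨z, hz, hzv⟩ := h'
    exact ⟨z, ih hz, hzv⟩

theorem Reach.uncons {n : ℕ} {u v : ℝ} (h : P.Reach (n + 1) u v) :
    ∃ w, P.Step u w ∧ P.Reach n w v := by
  induction n generalizing v with
  | zero => exact ⟨v, reach_one.1 h, rfl⟩
  | succ n ih =>
    obtain ⟨z, hz, hzv⟩ := h
    obtain ⟨w, hw, hwz⟩ := ih hz
    exact ⟨w, hw, z, hwz, hzv⟩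

theorem traj_mem_Xstar {x : ℝ} (hx : x ∈ P.Xtilde) (n : ℕ) : P.traj x n ∈ P.Xstar :=
  mem_iInter.1 hx n

theorem traj_succ (x : ℝ) (n : ℕ) : P.traj x (n + 1) = P.f (P.traj x n) :=
  Function.iterate_succ_apply' ..

theorem traj_traj (x : ℝ) (m n : ℕ) : P.traj (P.traj x m) n = P.traj x (m + n) := by
  simp only [traj]
  rw [add_comm, Function.iterate_add_apply]

theorem traj_mem_Xtilde {x : ℝ} (hx : x ∈ P.Xtilde) (n : ℕ) : P.traj x n ∈ P.Xtilde :=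
  mem_iInter.2 fun k => by
    have := traj_mem_Xstar hx (n + k)
    rwa [← traj_traj] at this

theorem Xtilde_subset_Xstar : P.Xtilde ⊆ P.Xstar := fun _ hx => mem_iInter.1 hx 0

theorem apply_mem_Xtilde {x : ℝ} (hx : x ∈ P.Xtilde) : P.f x ∈ P.Xtilde := traj_mem_Xtilde hx 1

theorem traj_mem_X {x : ℝ} (hx : x ∈ P.Xtilde) (n : ℕ) : P.traj x n ∈ P.X :=
  P.Xstar_subset_X (traj_mem_Xstar hx n)

theorem reach_traj {x : ℝ} (hx : x ∈ P.Xtilde) (m k : ℕ) :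
    P.Reach k (P.traj x m) (P.traj x (m + k)) := by
  induction k with
  | zero => exact rfl
  | succ k ih =>
    refine ⟨_, ih, ?_⟩
    rw [← add_assoc, traj_succ]
    exact step_of_mem_Xstar (traj_mem_Xstar hx _)

theorem shifting_traj {x : ℝ} (hx : x ∈ P.Xtilde) : P.Shifting (P.traj x) :=
  fun k n => ⟨n, fun m hm => ⟨m + k, by omega, reach_traj hx m k⟩⟩

theorem shifting_of_backward {y : ℕ → ℝ} (hy : ∀ n, P.Step (y (n + 1)) (y n)) :
    (∀ k m, P.Reach k (y (m + k)) (y m)) ∧ P.Shifting y := by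
  have key : ∀ k m, P.Reach k (y (m + k)) (y m) := by
    intro k
    induction k with
    | zero => exact fun m => rfl
    | succ k ih => exact fun m => Reach.cons (hy (m + k)) (ih m)
  refine ⟨key, fun k n => ⟨n + k, fun m hm => ⟨m - k, by omega, ?_⟩⟩⟩
  have := key k (m - k)
  rwa [Nat.sub_add_cancel (by omega)] at this

theorem branch_mem_Xtilde (hD : P.D ⊆ P.Xtilde) {i : Fin P.N} {c : ℝ} (hc : c ∈ P.Delta)
    (hx : c ∈ closure (P.piece i)) : P.branch i c ∈ P.Xtilde :=
  hD (P.branch_mem_D hc hx)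

theorem Accumulates.mem_closure {u : ℕ → ℝ} {c : ℝ} {i : Fin P.N} (h : P.Accumulates u c i) :
    c ∈ closure (P.piece i) := by
  refine Metric.mem_closure_iff.2 fun ε hε => ?_
  obtain ⟨m, -, hm, hmc⟩ := h.2 ε hε 0
  exact ⟨_, hm, by rwa [dist_comm, Real.dist_eq]⟩

theorem Reach.abs_sub_le {p ρ : ℝ} (hp : p ∈ P.Xtilde) {n : ℕ}
    (hρ : ∀ k < n, ∀ c ∈ P.Delta, ρ ≤ |P.traj p k - c|) {u v : ℝ} (hu : |u - p| < ρ)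
    (h : P.Reach n u v) : |v - P.traj p n| ≤ P.lam ^ n * |u - p| := by
  induction n generalizing v with
  | zero => simp [show u = v from h, traj]
  | succ n ih =>
    obtain ⟨w, hw, i, hwi, rfl⟩ := h
    have h1 := ih (fun k hk => hρ k (by omega)) hw
    have h2 : |w - P.traj p n| < ρ := h1.trans_lt <|
      (mul_le_of_le_one_left (abs_nonneg _) (pow_le_one₀ P.hlam₀.le P.hlam₁.le)).trans_lt hu
    obtain ⟨j, hj⟩ := mem_iUnion.1 (traj_mem_Xstar hp n)
    have hwj : w ∈ P.piece j := by
      by_contra hwj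
      obtain ⟨c, hc, -, hcw⟩ :=
        P.exists_mem_Delta_between hj (P.closure_piece_subset_X i hwi) hwj
      have := hρ n (by omega) c hc
      rw [abs_sub_comm (P.traj p n) w] at hcw
      linarith
    rw [P.eq_of_mem_closure_of_mem hwi hwj, traj_succ, ← P.branch_eq hj]
    refine (P.abs_branch_sub_le j _ _).trans ?_
    rw [pow_succ', mul_assoc]
    exact mul_le_mul_of_nonneg_left h1 P.hlam₀.le

theorem eventually_le_of_pos {x : ℝ} (hx : 0 < x) : ∀ᶠ ρ in 𝓝[>] (0 : ℝ), ρ ≤ x :=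
  mem_nhdsWithin_of_mem_nhds (Iic_mem_nhds hx)

theorem exists_pos_of_eventually {Q : ℝ → Prop} (h : ∀ᶠ ρ in 𝓝[>] (0 : ℝ), Q ρ) :
    ∃ ρ > 0, Q ρ := by
  obtain ⟨ρ, h1, h2⟩ := (h.and self_mem_nhdsWithin).exists
  exact ⟨ρ, h2, h1⟩

theorem eventually_dist_Delta {x : ℝ} (hx : x ∈ P.Xstar) :
    ∀ᶠ ρ in 𝓝[>] (0 : ℝ), ∀ c ∈ P.Delta, ρ ≤ |x - c| := by
  refine (eventually_all_finite P.finite_Delta).2 fun c hc => eventually_le_of_pos ?_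
  exact abs_pos.2 (sub_ne_zero.2 fun h => hc.2 (h ▸ hx))

theorem exists_reach_close {d : ℝ} (hd : d ∈ P.Xtilde) (k : ℕ) {ε : ℝ} (hε : 0 < ε) :
    ∃ r > 0, ∀ w, |w - d| < r → ∀ v, P.Reach k w v → |v - P.traj d k| < ε := by
  have h : ∀ᶠ ρ in 𝓝[>] (0 : ℝ), ∀ j ∈ Iio k, ∀ c ∈ P.Delta, ρ ≤ |P.traj d j - c| :=
    (eventually_all_finite (finite_Iio k)).2 fun j _ => eventually_dist_Delta (traj_mem_Xstar hd j)
  obtain ⟨ρ, hρ, h1, h2⟩ := exists_pos_of_eventually (h.and (eventually_le_of_pos hε))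
  refine ⟨ρ, hρ, fun w hw v hv => ?_⟩
  exact ((hv.abs_sub_le hd h1 hw).trans
    (mul_le_of_le_one_left (abs_nonneg _) (pow_le_one₀ P.hlam₀.le P.hlam₁.le))).trans_lt
    (hw.trans_le h2)

/-- Avoidance of the boundary, one-sidedly and uniformly, where there is no accumulation. -/
theorem eventually_far_of_not_accumulates (u : ℕ → ℝ) :
    ∀ᶠ ρ in 𝓝[>] (0 : ℝ), ∀ c ∈ P.Delta, ∀ i, ¬ P.Accumulates u c i →
      ∀ n, u n ∈ P.piece i → ρ ≤ |u n - c| := by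
  refine (eventually_all_finite P.finite_Delta).2 fun c hc => eventually_all.2 fun i => ?_
  by_cases hA : P.Accumulates u c i
  · exact Eventually.of_forall fun ρ h => absurd hA h
  have hA' := hA
  simp only [Accumulates, hc, true_and, not_forall, not_exists, not_and, not_lt] at hA'
  obtain ⟨ε, hε, N, hN⟩ := hA'
  have h : ∀ᶠ ρ in 𝓝[>] (0 : ℝ), ∀ n ∈ Iio N, u n ∈ P.piece i → ρ ≤ |u n - c| := by
    refine (eventually_all_finite (finite_Iio N)).2 fun n _ => ?_
    by_cases hn : u n ∈ P.piece i
    · refine (eventually_le_of_pos (abs_pos.2 (sub_ne_zero.2 fun h => ?_))).mono fun ρ h _ => h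
      exact P.notMem_piece_of_mem_Delta hc i (h ▸ hn)
    · exact Eventually.of_forall fun ρ h => absurd h hn
  filter_upwards [h, eventually_le_of_pos hε] with ρ h1 h2 _ n hn
  rcases lt_or_ge n N with h3 | h3
  · exact h1 n h3 hn
  · exact h2.trans (hN n h3 hn)

theorem exists_far_of_forall_not_accumulates {u : ℕ → ℝ} (hu : ∀ n, u n ∈ P.Xstar)
    (h : ∀ c i, ¬ P.Accumulates u c i) :
    ∃ ρ > 0, ∀ n, ∀ c ∈ P.Delta, ρ ≤ |u n - c| := by
  obtain ⟨ρ, hρ, h1⟩ := exists_pos_of_eventually (P.eventually_far_of_not_accumulates u)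
  refine ⟨ρ, hρ, fun n c hc => ?_⟩
  obtain ⟨i, hi⟩ := mem_iUnion.1 (hu n)
  obtain ⟨c', hc', -, hcc⟩ :=
    P.exists_mem_Delta_between hi hc.1 (P.notMem_piece_of_mem_Delta hc i)
  exact (h1 c' hc' i (h c' i) n hi).trans hcc

/-- `y` is a cluster point of the real sequence `u`. -/
def _root_.IsSeqClusterPt (u : ℕ → ℝ) (y : ℝ) : Prop :=
  ∀ ε > 0, ∀ n, ∃ m ≥ n, |u m - y| < ε

theorem mem_omegaLimitSet_iff {x y : ℝ} :
    y ∈ P.omegaLimitSet x ↔ IsSeqClusterPt (P.traj x) y := by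
  simp only [omegaLimitSet, mem_iInter, Metric.mem_closure_iff]
  constructor
  · intro h ε hε n
    obtain ⟨_, ⟨m, hm, rfl⟩, hd⟩ := h n ε hε
    exact ⟨m, hm, by rwa [dist_comm, Real.dist_eq] at hd⟩
  · intro h n ε hε
    obtain ⟨m, hm, hd⟩ := h ε hε n
    exact ⟨_, ⟨m, hm, rfl⟩, by rwa [dist_comm, Real.dist_eq]⟩

theorem exists_cluster_near {u : ℕ → ℝ} (hu : ∀ n, u n ∈ P.X) {ε : ℝ} (hε : 0 < ε) :
    ∃ J, ∀ m ≥ J, ∃ z, IsSeqClusterPt u z ∧ |u m - z| < ε := by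
  by_contra hcon
  push Not at hcon
  obtain ⟨φ, hφ, hφ'⟩ := extraction_of_frequently_atTop (frequently_atTop.2 hcon)
  obtain ⟨z, -, ψ, hψ, hlim⟩ := (isCompact_Icc : IsCompact P.X).tendsto_subseq fun n => hu (φ n)
  have hz : IsSeqClusterPt u z := by
    intro η hη n
    obtain ⟨N, hN⟩ := Metric.tendsto_atTop.1 hlim η hη
    refine ⟨φ (ψ (max n N)), ?_, ?_⟩
    · exact (le_max_left n N).trans ((hφ.comp hψ).le_apply)
    · simpa [Real.dist_eq] using hN _ (le_max_right n N)
  obtain ⟨N, hN⟩ := Metric.tendsto_atTop.1 hlim ε hε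
  have h1 := hN N le_rfl
  have h2 := hφ' (ψ N) z hz
  simp only [Function.comp, Real.dist_eq] at h1
  linarith

theorem Accumulates.cluster_branch {u : ℕ → ℝ} (hs : P.Shifting u) {c : ℝ} {i : Fin P.N}
    (h : P.Accumulates u c i) : IsSeqClusterPt u (P.branch i c) := by
  intro ε hε n
  obtain ⟨N, hN⟩ := hs 1 n
  obtain ⟨m, hm, hmi, hmc⟩ := h.2 ε hε N
  obtain ⟨m', hm', hr⟩ := hN m hm
  refine ⟨m', hm', ?_⟩
  rw [(reach_one.1 hr).eq_branch hmi]
  refine (P.abs_branch_sub_le _ _ _).trans_lt (lt_of_le_of_lt ?_ hmc)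
  exact mul_le_of_le_one_left (abs_nonneg _) P.hlam₁.le

theorem cluster_traj {u : ℕ → ℝ} (hs : P.Shifting u) {d : ℝ} (hd : d ∈ P.Xtilde)
    (h : IsSeqClusterPt u d) (k : ℕ) : IsSeqClusterPt u (P.traj d k) := by
  intro ε hε n
  obtain ⟨r, hr, h1⟩ := exists_reach_close hd k hε
  obtain ⟨N, hN⟩ := hs k n
  obtain ⟨m, hm, hmd⟩ := h r hr N
  obtain ⟨m', hm', hmm⟩ := hN m hm
  exact ⟨m', hm', h1 _ hmd _ hmm⟩

theorem cluster_of_frequently_close {u : ℕ → ℝ} {y : ℝ}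
    (h : ∀ ε > 0, ∃ z, IsSeqClusterPt u z ∧ |z - y| < ε) : IsSeqClusterPt u y := by
  intro ε hε n
  obtain ⟨z, hz, hzy⟩ := h (ε / 2) (half_pos hε)
  obtain ⟨m, hm, hmz⟩ := hz (ε / 2) (half_pos hε) n
  refine ⟨m, hm, ?_⟩
  have := abs_sub_le (u m) z y
  linarith

theorem cluster_of_mem_omega {u : ℕ → ℝ} (hs : P.Shifting u) {d y : ℝ} (hd : d ∈ P.Xtilde)
    (h : IsSeqClusterPt u d) (hy : y ∈ P.omegaLimitSet d) : IsSeqClusterPt u y := by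
  refine cluster_of_frequently_close fun ε hε => ?_
  obtain ⟨m, -, hm⟩ := mem_omegaLimitSet_iff.1 hy ε hε 0
  exact ⟨_, cluster_traj hs hd h m, hm⟩

theorem accumulates_of_cluster {u : ℕ → ℝ} (huX : ∀ n, u n ∈ P.X) {v : ℕ → ℝ}
    (h : ∀ n, IsSeqClusterPt u (v n)) {c : ℝ} {i : Fin P.N} (hv : P.Accumulates v c i) :
    P.Accumulates u c i := by
  refine ⟨hv.1, fun ε hε n => ?_⟩
  obtain ⟨k, -, hk, hkc⟩ := hv.2 (ε / 2) (half_pos hε) 0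
  obtain ⟨η, hη, hball⟩ := P.exists_ball_inter_subset_piece hk
  obtain ⟨m, hm, hmk⟩ := h k (min η (ε / 2)) (lt_min hη (half_pos hε)) n
  rw [lt_min_iff] at hmk
  refine ⟨m, hm, hball _ (huX m) hmk.1, ?_⟩
  have := abs_sub_le (u m) (v k) c
  linarith

/-- Points of the tail of the orbit of `d` after time `n`, or of its ω-limit set, with
well-defined itineraries. -/
def Trap (P : PCIM) (d : ℝ) (n : ℕ) (p : ℝ) : Prop :=
  p ∈ P.Xtilde ∧ ((∃ m ≥ n, p = P.traj d m) ∨ p ∈ P.omegaLimitSet d)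

theorem Trap.apply {d : ℝ} (hd : d ∈ P.Xtilde) {n : ℕ} {p : ℝ} (h : P.Trap d n p) :
    P.Trap d (n + 1) (P.f p) := by
  refine ⟨apply_mem_Xtilde h.1, ?_⟩
  rcases h.2 with ⟨m, hm, rfl⟩ | h'
  · exact Or.inl ⟨m + 1, by omega, (traj_succ d m).symm⟩
  · right
    rw [mem_omegaLimitSet_iff] at h' ⊢
    exact cluster_traj (shifting_traj hd) h.1 h' 1

theorem Accumulates.trap_branch (hD : P.D ⊆ P.Xtilde) {d : ℝ} (hd : d ∈ P.Xtilde) {c : ℝ}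
    {i : Fin P.N} (h : P.Accumulates (P.traj d) c i) (n : ℕ) : P.Trap d n (P.branch i c) :=
  ⟨branch_mem_Xtilde hD h.1 h.mem_closure,
    Or.inr (mem_omegaLimitSet_iff.2 (h.cluster_branch (shifting_traj hd)))⟩

theorem Trap.far {d : ℝ} (hd : d ∈ P.Xtilde) {δ : ℝ} {c : ℝ} {i : Fin P.N}
    (hδ : ∀ n, P.traj d n ∈ P.piece i → δ ≤ |P.traj d n - c|) {n : ℕ} {p : ℝ}
    (hp : P.Trap d n p) (hpi : p ∈ P.piece i) : δ ≤ |p - c| := by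
  rcases hp.2 with ⟨m, -, rfl⟩ | h
  · exact hδ m hpi
  by_contra! hlt
  obtain ⟨η, hη, hball⟩ := P.exists_ball_inter_subset_piece hpi
  obtain ⟨m, -, hm⟩ := mem_omegaLimitSet_iff.1 h (min η (δ - |p - c|))
    (lt_min hη (sub_pos.2 hlt)) 0
  rw [lt_min_iff] at hm
  have h1 := hδ m (hball _ (traj_mem_X hd m) hm.1)
  have h2 := abs_sub_le (P.traj d m) p c
  linarith

theorem trap_step (hmono : P.PiecewiseMonotonic) (hD : P.D ⊆ P.Xtilde) {d δ : ℝ}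
    (hd : d ∈ P.Xtilde)
    (hδ : ∀ c ∈ P.Delta, ∀ i, ¬ P.Accumulates (P.traj d) c i →
      ∀ n, P.traj d n ∈ P.piece i → δ ≤ |P.traj d n - c|)
    (hδ' : ∀ i, ∃ s ∈ P.piece i, ∃ t ∈ P.piece i, δ ≤ t - s) {n : ℕ} {p q u v : ℝ}
    (hp : P.Trap d n p) (hq : P.Trap d n q) (hpu : p ≤ u) (huq : u ≤ q) (hpq : q - p < δ)
    (h : P.Step u v) : ∃ p' q', P.Trap d (n + 1) p' ∧ P.Trap d (n + 1) q' ∧ p' ≤ v ∧ v ≤ q' ∧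
      q' - p' ≤ P.lam * (q - p) := by
  obtain ⟨i, hui, rfl⟩ := h
  obtain ⟨l, r, hlr, hcl, hsub, hl, hr⟩ := P.exists_endpoints i
  have hui' : u ∈ Icc l r := hcl ▸ hui
  have hout : ∀ x ∈ P.Xtilde, x ∉ P.piece i → x ∉ closure (P.piece i) := fun x hx hxi hxc =>
    (P.mem_Delta_of_mem_closure hxc hxi).2 (Xtilde_subset_Xstar hx)
  have hX : ∀ x ∈ P.Xtilde, x ∈ P.X := fun x hx => P.Xstar_subset_X (Xtilde_subset_Xstar hx)
  have hlen : ¬ (p < l ∧ r < q) := by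
    rintro ⟨h1, h2⟩
    obtain ⟨s, hs, t, ht, hst⟩ := hδ' i
    have hs' : s ∈ Icc l r := hcl ▸ subset_closure hs
    have ht' : t ∈ Icc l r := hcl ▸ subset_closure ht
    linarith [hs'.1, ht'.2]
  have hpl : p ∉ P.piece i → p < l := fun hpi => by
    have := hout p hp.1 hpi
    rw [hcl] at this
    by_contra! hlp
    exact this ⟨hlp, hpu.trans hui'.2⟩
  have hqr : q ∉ P.piece i → r < q := fun hqi => by
    have := hout q hq.1 hqi
    rw [hcl] at this
    by_contra! hlp
    exact this ⟨hui'.1.trans huq, hlp⟩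
  have ha : ∃ a ∈ closure (P.piece i), p ≤ a ∧ a ≤ u ∧ P.Trap d (n + 1) (P.branch i a) := by
    by_cases hpi : p ∈ P.piece i
    · exact ⟨p, subset_closure hpi, le_rfl, hpu, P.branch_eq hpi ▸ hp.apply hd⟩
    have hpl := hpl hpi
    have hlΔ := hl p (hX p hp.1) hpl
    refine ⟨l, hcl ▸ left_mem_Icc.2 hlr.le, hpl.le, hui'.1, ?_⟩
    suffices hA : P.Accumulates (P.traj d) l i from hA.trap_branch hD hd _
    by_contra hA
    have hqi : q ∈ P.piece i := by
      by_contra hqi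
      exact hlen ⟨hpl, hqr hqi⟩
    have := hq.far hd (hδ l hlΔ i hA) hqi
    rw [abs_of_nonneg (by linarith [hui'.1])] at this
    linarith
  have hb : ∃ b ∈ closure (P.piece i), u ≤ b ∧ b ≤ q ∧ P.Trap d (n + 1) (P.branch i b) := by
    by_cases hqi : q ∈ P.piece i
    · exact ⟨q, subset_closure hqi, huq, le_rfl, P.branch_eq hqi ▸ hq.apply hd⟩
    have hqr := hqr hqi
    have hrΔ := hr q (hX q hq.1) hqr
    refine ⟨r, hcl ▸ right_mem_Icc.2 hlr.le, hui'.2, hqr.le, ?_⟩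
    suffices hA : P.Accumulates (P.traj d) r i from hA.trap_branch hD hd _
    by_contra hA
    have hpi : p ∈ P.piece i := by
      by_contra hpi
      exact hlen ⟨hpl hpi, hqr⟩
    have := hp.far hd (hδ r hrΔ i hA) hpi
    rw [abs_of_nonpos (by linarith [hui'.2])] at this
    linarith
  obtain ⟨a, hac, hpa, hau, hta⟩ := ha
  obtain ⟨b, hbc, hub, hbq, htb⟩ := hb
  have hlam := P.hlam₀
  have hlen' : |P.branch i a - P.branch i b| ≤ P.lam * (q - p) := by
    refine (P.abs_branch_sub_le i a b).trans (mul_le_mul_of_nonneg_left ?_ hlam.le)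
    rw [abs_of_nonpos (by linarith)]
    linarith
  rw [abs_le] at hlen'
  rcases P.branch_monotoneOn_or_antitoneOn hmono i with hm | hm
  · exact ⟨_, _, hta, htb, hm hac hui hau, hm hui hbc hub, by linarith [hlen'.1]⟩
  · exact ⟨_, _, htb, hta, hm hui hbc hub, hm hac hui hau, by linarith [hlen'.2]⟩

theorem trap_reach (hmono : P.PiecewiseMonotonic) (hD : P.D ⊆ P.Xtilde) {d δ : ℝ}
    (hd : d ∈ P.Xtilde)
    (hδ : ∀ c ∈ P.Delta, ∀ i, ¬ P.Accumulates (P.traj d) c i →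
      ∀ n, P.traj d n ∈ P.piece i → δ ≤ |P.traj d n - c|)
    (hδ' : ∀ i, ∃ s ∈ P.piece i, ∃ t ∈ P.piece i, δ ≤ t - s) {p q u : ℝ}
    (hp : P.Trap d 0 p) (hq : P.Trap d 0 q) (hpu : p ≤ u) (huq : u ≤ q) (hpq : q - p < δ)
    {n : ℕ} {v : ℝ} (h : P.Reach n u v) : ∃ p' q', P.Trap d n p' ∧ P.Trap d n q' ∧ p' ≤ v ∧
      v ≤ q' ∧ q' - p' ≤ P.lam ^ n * (q - p) := by
  induction n generalizing v with
  | zero => exact (show u = v from h) ▸ ⟨p, q, hp, hq, hpu, huq, by simp⟩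
  | succ n ih =>
    obtain ⟨w, hw, hwv⟩ := h
    obtain ⟨p', q', h1, h2, h3, h4, h5⟩ := ih hw
    have h6 : P.lam ^ n * (q - p) ≤ q - p :=
      mul_le_of_le_one_left (by linarith) (pow_le_one₀ P.hlam₀.le P.hlam₁.le)
    obtain ⟨p'', q'', g1, g2, g3, g4, g5⟩ :=
      trap_step hmono hD hd hδ hδ' h1 h2 h3 h4 (by linarith) hwv
    refine ⟨p'', q'', g1, g2, g3, g4, g5.trans ?_⟩
    rw [pow_succ', mul_assoc]
    exact mul_le_mul_of_nonneg_left h5 P.hlam₀.le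

theorem exists_pow_mul_lt {ε : ℝ} (hε : 0 < ε) (C : ℝ) :
    ∃ J, ∀ n ≥ J, P.lam ^ n * C < ε := by
  have h := (tendsto_pow_atTop_nhds_zero_of_lt_one P.hlam₀.le P.hlam₁).mul_const C
  rw [zero_mul] at h
  exact eventually_atTop.1 (h.eventually_lt_const hε)

theorem exists_omega_near {x : ℝ} (hx : x ∈ P.Xtilde) {ε : ℝ} (hε : 0 < ε) :
    ∃ J, ∀ m ≥ J, ∃ z ∈ P.omegaLimitSet x, |P.traj x m - z| < ε := by
  obtain ⟨J, hJ⟩ := exists_cluster_near (traj_mem_X hx) hε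
  refine ⟨J, fun m hm => ?_⟩
  obtain ⟨z, hz, hzm⟩ := hJ m hm
  exact ⟨z, mem_omegaLimitSet_iff.2 hz, hzm⟩

/-- Points close enough to some germ attached to `(c, i)` are attracted, uniformly, by the
ω-limit set of the one-sided image of `c`. -/
theorem exists_attracting_germ (hmono : P.PiecewiseMonotonic) (hD : P.D ⊆ P.Xtilde) {c : ℝ}
    {i : Fin P.N} (hc : c ∈ P.Delta) (hci : c ∈ closure (P.piece i)) :
    ∃ c' i', ((c' = c ∧ i' = i) ∨ P.Accumulates (P.traj (P.branch i c)) c' i') ∧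
      ∃ r > 0, ∀ ε > 0, ∃ J, ∀ n ≥ J, ∀ u v, u ∈ P.piece i' → |u - c'| < r → P.Reach n u v →
        ∃ z ∈ P.omegaLimitSet (P.branch i c), |v - z| < ε := by
  have hd := branch_mem_Xtilde hD hc hci
  set d := P.branch i c with hd_def
  by_cases hA : ∃ c' i', P.Accumulates (P.traj d) c' i'
  · obtain ⟨c', i', hA⟩ := hA
    refine ⟨c', i', Or.inr hA, ?_⟩
    have hpieces : ∀ᶠ δ in 𝓝[>] (0 : ℝ), ∀ i, ∃ s ∈ P.piece i, ∃ t ∈ P.piece i, δ ≤ t - s := by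
      refine eventually_all.2 fun j => ?_
      obtain ⟨l, r, hlr, -, hsub, -⟩ := P.exists_endpoints j
      refine (eventually_le_of_pos (half_pos (half_pos (sub_pos.2 hlr)))).mono fun δ h => ?_
      refine ⟨l + (r - l) / 4, hsub ⟨by linarith, by linarith⟩, l + (r - l) / 2,
        hsub ⟨by linarith, by linarith⟩, by linarith⟩
    obtain ⟨δ, hδ0, hδ, hδ'⟩ := exists_pos_of_eventually
      ((P.eventually_far_of_not_accumulates (P.traj d)).and hpieces)
    obtain ⟨m, -, hmi, hmc⟩ := hA.2 δ hδ0 0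
    have htrap : ∀ k, P.Trap d 0 (P.traj d k) := fun k =>
      ⟨traj_mem_Xtilde hd k, Or.inl ⟨k, Nat.zero_le _, rfl⟩⟩
    have hne : ∀ {x}, x ∈ P.piece i' → x ≠ c' := fun hx h =>
      P.notMem_piece_of_mem_Delta hA.1 i' (h ▸ hx)
    refine ⟨|P.traj d m - c'|, abs_pos.2 (sub_ne_zero.2 (hne hmi)), fun ε hε => ?_⟩
    obtain ⟨J₁, hJ₁⟩ := exists_omega_near hd (half_pos hε)
    obtain ⟨J₂, hJ₂⟩ := P.exists_pow_mul_lt (half_pos hε) δ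
    refine ⟨max J₁ J₂, fun n hn u v hu huc huv => ?_⟩
    obtain ⟨m', -, hmi', hmc'⟩ := hA.2 |u - c'| (abs_pos.2 (sub_ne_zero.2 (hne hu))) 0
    have hend : ∃ p q, P.Trap d 0 p ∧ P.Trap d 0 q ∧ p ≤ u ∧ u ≤ q ∧ q - p < δ := by
      obtain ⟨l, r, hlr, hcl, hsub, -⟩ := P.exists_endpoints i'
      have hcc : c' ∈ Icc l r := hcl ▸ hA.mem_closure
      have h1 : u ∈ Icc l r := hcl ▸ subset_closure hu
      have h2 : P.traj d m ∈ Icc l r := hcl ▸ subset_closure hmi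
      have h3 : P.traj d m' ∈ Icc l r := hcl ▸ subset_closure hmi'
      have hlor : c' = l ∨ c' = r := by
        by_contra! hcon
        exact P.notMem_piece_of_mem_Delta hA.1 i'
          (hsub ⟨lt_of_le_of_ne hcc.1 hcon.1.symm, lt_of_le_of_ne hcc.2 hcon.2⟩)
      rcases hlor with rfl | rfl
      · rw [abs_of_nonneg (sub_nonneg.2 h1.1)] at huc hmc'
        rw [abs_of_nonneg (sub_nonneg.2 h2.1)] at huc hmc
        rw [abs_of_nonneg (sub_nonneg.2 h3.1)] at hmc'
        exact ⟨_, _, htrap m', htrap m, by linarith, by linarith, by linarith [h3.1]⟩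
      · rw [abs_of_nonpos (sub_nonpos.2 h1.2)] at huc hmc'
        rw [abs_of_nonpos (sub_nonpos.2 h2.2)] at huc hmc
        rw [abs_of_nonpos (sub_nonpos.2 h3.2)] at hmc'
        exact ⟨_, _, htrap m, htrap m', by linarith, by linarith, by linarith [h3.2]⟩
    obtain ⟨p, q, hp, hq, hpu, huq, hpq⟩ := hend
    obtain ⟨p', q', hp', -, h1, h2, h3⟩ := trap_reach hmono hD hd hδ hδ' hp hq hpu huq hpq huv
    have h4 : |v - p'| < ε / 2 := by
      rw [abs_of_nonneg (by linarith)]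
      refine lt_of_le_of_lt ?_ (hJ₂ n (le_of_max_le_right hn))
      have := mul_le_mul_of_nonneg_left hpq.le (pow_nonneg P.hlam₀.le n)
      linarith
    rcases hp'.2 with ⟨k, hk, rfl⟩ | hω
    · obtain ⟨z, hz, hkz⟩ := hJ₁ k ((le_of_max_le_left hn).trans hk)
      refine ⟨z, hz, ?_⟩
      have := abs_sub_le v (P.traj d k) z
      linarith
    · exact ⟨p', hω, by linarith⟩
  · push Not at hA
    obtain ⟨ρ, hρ0, hρ⟩ := exists_far_of_forall_not_accumulates (traj_mem_Xstar hd) hA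
    refine ⟨c, i, Or.inl ⟨rfl, rfl⟩, ρ, hρ0, fun ε hε => ?_⟩
    obtain ⟨J₁, hJ₁⟩ := exists_omega_near hd (half_pos hε)
    obtain ⟨J₂, hJ₂⟩ := P.exists_pow_mul_lt (half_pos hε) ρ
    refine ⟨max J₁ J₂ + 1, fun n hn u v hu huc huv => ?_⟩
    obtain ⟨n, rfl⟩ : ∃ n', n = n' + 1 := ⟨n - 1, by omega⟩
    obtain ⟨w, huw, hwv⟩ := huv.uncons
    have hwd : |w - d| < ρ := by
      rw [huw.eq_branch hu, hd_def]
      refine (P.abs_branch_sub_le i u c).trans_lt (lt_of_le_of_lt ?_ huc)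
      exact mul_le_of_le_one_left (abs_nonneg _) P.hlam₁.le
    have h1 := hwv.abs_sub_le hd (fun k _ => hρ k) hwd
    have h2 := mul_le_mul_of_nonneg_left hwd.le (pow_nonneg P.hlam₀.le n)
    have h3 := hJ₂ n (by omega)
    obtain ⟨z, hz, hnz⟩ := hJ₁ n (by omega)
    refine ⟨z, hz, ?_⟩
    have := abs_sub_le v (P.traj d n) z
    linarith

theorem mem_X_of_cluster {u : ℕ → ℝ} (hu : ∀ n, u n ∈ P.X) {y : ℝ} (h : IsSeqClusterPt u y) :
    y ∈ P.X := by
  have : y ∈ closure P.X := Metric.mem_closure_iff.2 fun ε hε => by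
    obtain ⟨m, -, hm⟩ := h ε hε 0
    exact ⟨_, hu m, by rwa [dist_comm, Real.dist_eq]⟩
  exact closure_minimal Subset.rfl isClosed_Icc this

theorem omega_subset_X {x : ℝ} (hx : x ∈ P.Xtilde) : P.omegaLimitSet x ⊆ P.X :=
  fun _ hy => mem_X_of_cluster (traj_mem_X hx) (mem_omegaLimitSet_iff.1 hy)

theorem omega_nonempty {x : ℝ} (hx : x ∈ P.Xtilde) : (P.omegaLimitSet x).Nonempty := by
  obtain ⟨J, hJ⟩ := exists_omega_near hx one_pos
  obtain ⟨z, hz, -⟩ := hJ J le_rfl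
  exact ⟨z, hz⟩

theorem isClosed_omega (x : ℝ) : IsClosed (P.omegaLimitSet x) :=
  isClosed_iInter fun _ => isClosed_closure

theorem isCompact_omega {x : ℝ} (hx : x ∈ P.Xtilde) : IsCompact (P.omegaLimitSet x) :=
  isCompact_Icc.of_isClosed_subset (isClosed_omega x) (omega_subset_X hx)

theorem exists_far_cluster {u : ℕ → ℝ} (hs : P.Shifting u) (hu : ∀ n, u n ∈ P.X) {n₀ : ℕ}
    (hu' : ∀ n ≥ n₀, u n ∈ P.Xstar) (h : ∀ c i, ¬ P.Accumulates u c i) :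
    ∃ ρ > 0, ∀ z, IsSeqClusterPt u z →
      z ∈ P.Xtilde ∧ ∀ k, ∀ c ∈ P.Delta, ρ ≤ |P.traj z k - c| := by
  obtain ⟨ρ, hρ, hfar⟩ := exists_far_of_forall_not_accumulates (P := P)
    (u := fun n => u (n + n₀)) (fun n => hu' _ (Nat.le_add_left _ _)) fun c i hA =>
      h c i ⟨hA.1, fun ε hε n => by
        obtain ⟨m, hm, hm'⟩ := hA.2 ε hε n
        exact ⟨m + n₀, by omega, hm'⟩⟩
  have hclose : ∀ z, IsSeqClusterPt u z → ∀ c ∈ P.Delta, ρ ≤ |z - c| := by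
    intro z hz c hc
    by_contra! hlt
    obtain ⟨m, hm, hmz⟩ := hz (ρ - |z - c|) (sub_pos.2 hlt) n₀
    have h1 := hfar (m - n₀) c hc
    rw [Nat.sub_add_cancel hm] at h1
    have h2 := abs_sub_le (u m) z c
    linarith
  have hstar : ∀ z, IsSeqClusterPt u z → z ∈ P.Xstar := by
    intro z hz
    by_contra hzs
    have := hclose z hz z ⟨mem_X_of_cluster hu hz, hzs⟩
    rw [sub_self, abs_zero] at this
    linarith
  have hstep : ∀ z, IsSeqClusterPt u z → IsSeqClusterPt u (P.f z) := by
    intro z hz ε hε n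
    obtain ⟨i, hi⟩ := mem_iUnion.1 (hstar z hz)
    obtain ⟨η, hη, hball⟩ := P.exists_ball_inter_subset_piece hi
    obtain ⟨N, hN⟩ := hs 1 n
    obtain ⟨m, hm, hmz⟩ := hz (min η ε) (lt_min hη hε) N
    rw [lt_min_iff] at hmz
    obtain ⟨m', hm', hr⟩ := hN m hm
    refine ⟨m', hm', ?_⟩
    rw [(reach_one.1 hr).eq_branch (hball _ (hu m) hmz.1), ← P.branch_eq hi]
    refine (P.abs_branch_sub_le _ _ _).trans_lt (lt_of_le_of_lt ?_ hmz.2)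
    exact mul_le_of_le_one_left (abs_nonneg _) P.hlam₁.le
  have hall : ∀ z, IsSeqClusterPt u z → ∀ k, IsSeqClusterPt u (P.traj z k) := by
    intro z hz k
    induction k with
    | zero => exact hz
    | succ k ih => exact traj_succ z k ▸ hstep _ ih
  exact ⟨ρ, hρ, fun z hz => ⟨mem_iInter.2 fun k => hstar _ (hall z hz k),
    fun k => hclose _ (hall z hz k)⟩⟩

theorem omega_subset_of_asymptotic {x y : ℝ} {a b : ℕ}
    (h : ∀ ε > 0, ∃ J, ∀ n ≥ J, |P.traj x (n + a) - P.traj y (n + b)| < ε) :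
    P.omegaLimitSet x ⊆ P.omegaLimitSet y := by
  intro z hz
  rw [mem_omegaLimitSet_iff] at hz ⊢
  intro ε hε n
  obtain ⟨J, hJ⟩ := h (ε / 2) (half_pos hε)
  obtain ⟨m, hm, hmz⟩ := hz (ε / 2) (half_pos hε) (J + n + a)
  have h1 := hJ (m - a) (by omega)
  rw [Nat.sub_add_cancel (by omega)] at h1
  refine ⟨m - a + b, by omega, ?_⟩
  have h2 := abs_sub_le (P.traj y (m - a + b)) (P.traj x m) z
  rw [abs_sub_comm (P.traj y (m - a + b)) (P.traj x m)] at h2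
  linarith

theorem omega_eq_of_asymptotic {x y : ℝ} {a b : ℕ}
    (h : ∀ ε > 0, ∃ J, ∀ n ≥ J, |P.traj x (n + a) - P.traj y (n + b)| < ε) :
    P.omegaLimitSet x = P.omegaLimitSet y :=
  (omega_subset_of_asymptotic h).antisymm <| omega_subset_of_asymptotic (a := b) (b := a)
    fun ε hε => by simpa only [abs_sub_comm] using h ε hε

theorem omega_traj (x : ℝ) (k : ℕ) : P.omegaLimitSet (P.traj x k) = P.omegaLimitSet x := by
  refine omega_eq_of_asymptotic (a := 0) (b := k) fun ε hε => ⟨0, fun n _ => ?_⟩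
  rw [traj_traj, add_zero, add_comm, sub_self, abs_zero]
  exact hε

theorem traj_asymptotic {x p ρ : ℝ} (hx : x ∈ P.Xtilde) (hp : p ∈ P.Xtilde)
    (hρ : ∀ k, ∀ c ∈ P.Delta, ρ ≤ |P.traj p k - c|) {a : ℕ} (h : |P.traj x a - p| < ρ)
    {ε : ℝ} (hε : 0 < ε) : ∃ J, ∀ n ≥ J, |P.traj x (n + a) - P.traj p n| < ε := by
  obtain ⟨J, hJ⟩ := P.exists_pow_mul_lt hε ρ
  refine ⟨J, fun n hn => ?_⟩
  have h1 := (reach_traj hx a n).abs_sub_le hp (fun k _ => hρ k) h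
  have h2 := mul_le_mul_of_nonneg_left h.le (pow_nonneg P.hlam₀.le n)
  rw [add_comm]
  linarith [hJ n hn]

theorem omega_eq_of_close {x p ρ : ℝ} (hx : x ∈ P.Xtilde) (hp : p ∈ P.Xtilde)
    (hρ : ∀ k, ∀ c ∈ P.Delta, ρ ≤ |P.traj p k - c|) {a : ℕ} (h : |P.traj x a - p| < ρ) :
    P.omegaLimitSet x = P.omegaLimitSet p :=
  omega_eq_of_asymptotic (a := a) (b := 0) fun _ hε => traj_asymptotic hx hp hρ h hε

theorem orbit_subset_Xtilde {x : ℝ} (hx : x ∈ P.Xtilde) : P.orbit x ⊆ P.Xtilde := by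
  rintro _ ⟨k, rfl⟩
  exact traj_mem_Xtilde hx k

theorem mem_closure_orbit_of_mem_omega {x y : ℝ} (h : y ∈ P.omegaLimitSet x) :
    y ∈ closure (P.orbit x) := by
  refine closure_mono ?_ (mem_iInter.1 h 0)
  rintro _ ⟨m, -, rfl⟩
  exact ⟨m, rfl⟩

theorem omega_eq_orbit_of_periodic {z : ℝ} {q : ℕ} (hq : 1 ≤ q) (hz : P.f^[q] z = z) :
    P.omegaLimitSet z = P.orbit z := by
  have hper : Function.IsPeriodicPt P.f q z := hz
  apply Subset.antisymm
  · intro y hy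
    have hfin : (P.orbit z).Finite := by
      refine ((finite_Iio q).image fun k => P.f^[k] z).subset ?_
      rintro _ ⟨k, rfl⟩
      exact ⟨k % q, Nat.mod_lt _ hq, hper.iterate_mod_apply k⟩
    exact hfin.isClosed.closure_eq ▸ mem_closure_orbit_of_mem_omega hy
  · rintro _ ⟨k, rfl⟩
    refine mem_omegaLimitSet_iff.2 fun ε hε n => ⟨k + n * q, ?_, ?_⟩
    · have := Nat.le_mul_of_pos_right n hq
      omega
    · have h1 : P.traj z (k + n * q) = P.f^[k] z := by
        rw [traj, Function.iterate_add_apply, hper.const_mul n]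
      rw [h1, sub_self, abs_zero]
      exact hε

theorem exists_periodic_of_not_accumulates {x : ℝ} (hx : x ∈ P.Xtilde)
    (h : ∀ c i, ¬ P.Accumulates (P.traj x) c i) :
    ∃ z ∈ P.Xtilde, ∃ q, 1 ≤ q ∧ P.f^[q] z = z ∧ P.omegaLimitSet x = P.orbit z := by
  obtain ⟨ρ₁, hρ₁, hfar⟩ := exists_far_cluster (shifting_traj hx) (traj_mem_X hx) (n₀ := 0)
    (fun n _ => traj_mem_Xstar hx n) h
  obtain ⟨ρ₂, hρ₂, hfar'⟩ := exists_far_of_forall_not_accumulates (traj_mem_Xstar hx) h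
  obtain ⟨z, hz⟩ := omega_nonempty hx
  have hzc := mem_omegaLimitSet_iff.1 hz
  obtain ⟨m, -, hm⟩ := hzc (ρ₂ / 2) (half_pos hρ₂) 0
  obtain ⟨m', hmm', hm'⟩ := hzc (ρ₂ / 2) (half_pos hρ₂) (m + 1)
  obtain ⟨q, rfl⟩ : ∃ q, m' = m + q := ⟨m' - m, by omega⟩
  have hq : 1 ≤ q := by omega
  have hclose : |P.traj x (m + q) - P.traj x m| < ρ₂ := by
    have := abs_sub_le (P.traj x (m + q)) z (P.traj x m)
    rw [abs_sub_comm z] at this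
    linarith
  obtain ⟨hzX, hzfar⟩ := hfar z hzc
  have hper : P.f^[q] z = z := by
    refine sub_eq_zero.1 (abs_eq_zero.1 (le_antisymm (le_of_forall_pos_lt_add fun ε hε => ?_)
      (abs_nonneg _)))
    rw [zero_add]
    obtain ⟨J, hJ⟩ := traj_asymptotic hx (traj_mem_Xtilde hx m)
      (fun k c hc => by rw [traj_traj]; exact hfar' _ c hc) hclose (div_pos hε three_pos)
    obtain ⟨r, hr, hreach⟩ := exists_reach_close hzX q (div_pos hε three_pos)
    obtain ⟨n, hn, hnz⟩ := hzc (min r (ε / 3)) (lt_min hr (div_pos hε three_pos)) (J + m)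
    rw [lt_min_iff] at hnz
    have h1 := hreach _ hnz.1 _ (reach_traj hx n q)
    have h2 := hJ (n - m) (by omega)
    rw [traj_traj, show n - m + (m + q) = n + q by omega, show m + (n - m) = n by omega] at h2
    have h3 := abs_sub_le (P.traj z q) (P.traj x (n + q)) z
    have h4 := abs_sub_le (P.traj x (n + q)) (P.traj x n) z
    rw [abs_sub_comm (P.traj z q) (P.traj x (n + q))] at h3
    change |P.traj z q - z| < ε
    linarith [hnz.2]
  refine ⟨z, hzX, q, hq, hper, ?_⟩
  rw [← omega_eq_orbit_of_periodic hq hper]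
  obtain ⟨a, -, ha⟩ := hzc ρ₁ hρ₁ 0
  exact omega_eq_of_close hx hzX hzfar ha

theorem exists_omega_eq_of_not_accumulates (hD : P.D ⊆ P.Xtilde) (hΔ : P.Delta.Nonempty) {x : ℝ}
    (hx : x ∈ P.Xtilde) (h : ∀ c i, ¬ P.Accumulates (P.traj x) c i) :
    ∃ c ∈ P.Delta, ∃ i, c ∈ closure (P.piece i) ∧
      P.omegaLimitSet x = P.omegaLimitSet (P.branch i c) := by
  obtain ⟨ρ, hρ, hfar⟩ := exists_far_of_forall_not_accumulates (traj_mem_Xstar hx) h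
  obtain ⟨c₀, hc₀⟩ := hΔ
  let S : Set ℝ := {s | ∃ n, ∃ c ∈ P.Delta, s = |P.traj x n - c|}
  have hne : S.Nonempty := ⟨_, 0, c₀, hc₀, rfl⟩
  have hlow : ∀ s ∈ S, ρ ≤ s := by
    rintro _ ⟨n, c, hc, rfl⟩
    exact hfar n c hc
  have hpos : 0 < sInf S := hρ.trans_le (le_csInf hne hlow)
  have hlam := P.hlam₀
  obtain ⟨_, ⟨n, c, hc, rfl⟩, hlt⟩ := exists_lt_of_csInf_lt hne
    (show sInf S < sInf S / P.lam from (lt_div_iff₀ hlam).2 (by nlinarith [P.hlam₁]))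
  obtain ⟨j, hj⟩ := mem_iUnion.1 (traj_mem_Xstar hx n)
  obtain ⟨c', hc', hcj, hcc⟩ :=
    P.exists_mem_Delta_between hj hc.1 (P.notMem_piece_of_mem_Delta hc j)
  refine ⟨c', hc', j, hcj, ?_⟩
  rw [← omega_traj x (n + 1)]
  symm
  refine omega_eq_of_close (ρ := sInf S) (a := 0) (branch_mem_Xtilde hD hc' hcj)
    (traj_mem_Xtilde hx _) (fun k c hc => ?_) ?_
  · rw [traj_traj]
    exact csInf_le ⟨ρ, hlow⟩ ⟨_, c, hc, rfl⟩
  · change |P.branch j c' - P.traj x (n + 1)| < sInf S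
    rw [traj_succ, ← P.branch_eq hj]
    refine (P.abs_branch_sub_le _ _ _).trans_lt ?_
    rw [lt_div_iff₀' hlam] at hlt
    rw [abs_sub_comm]
    exact (mul_le_mul_of_nonneg_left hcc hlam.le).trans_lt hlt

theorem mem_of_isClosed_of_close {A : Set ℝ} (hA : IsClosed A) {y : ℝ}
    (h : ∀ ε > 0, ∃ z ∈ A, |y - z| < ε) : y ∈ A := by
  rw [← hA.closure_eq]
  refine Metric.mem_closure_iff.2 fun ε hε => ?_
  obtain ⟨z, hz, hyz⟩ := h ε hε
  exact ⟨z, hz, by rwa [Real.dist_eq]⟩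

theorem attracting_accumulates (hmono : P.PiecewiseMonotonic) (hD : P.D ⊆ P.Xtilde) {u : ℕ → ℝ}
    (hs : P.Shifting u) (hu : ∀ n, u n ∈ P.X) {c : ℝ} {i : Fin P.N} (h : P.Accumulates u c i) :
    ∃ c' i', P.Accumulates u c' i' ∧
      ∃ r > 0, ∀ ε > 0, ∃ J, ∀ n ≥ J, ∀ u v, u ∈ P.piece i' → |u - c'| < r → P.Reach n u v →
        ∃ z ∈ P.omegaLimitSet (P.branch i c), |v - z| < ε := by
  obtain ⟨c', i', hor, hr⟩ := exists_attracting_germ hmono hD h.1 h.mem_closure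
  refine ⟨c', i', ?_, hr⟩
  rcases hor with ⟨rfl, rfl⟩ | hA
  · exact h
  · exact accumulates_of_cluster hu
      (cluster_traj hs (branch_mem_Xtilde hD h.1 h.mem_closure) (h.cluster_branch hs)) hA

theorem Accumulates.omega_eq (hmono : P.PiecewiseMonotonic) (hD : P.D ⊆ P.Xtilde) {x : ℝ}
    (hx : x ∈ P.Xtilde) {c : ℝ} {i : Fin P.N} (h : P.Accumulates (P.traj x) c i) :
    P.omegaLimitSet x = P.omegaLimitSet (P.branch i c) := by
  have hs := shifting_traj hx
  apply Subset.antisymm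
  · intro y hy
    obtain ⟨c', i', hA, r, hr, hattr⟩ := attracting_accumulates hmono hD hs (traj_mem_X hx) h
    obtain ⟨t, -, hti, htc⟩ := hA.2 r hr 0
    refine mem_of_isClosed_of_close (isClosed_omega _) fun ε hε => ?_
    obtain ⟨J, hJ⟩ := hattr (ε / 2) (half_pos hε)
    obtain ⟨m, hm, hmy⟩ := mem_omegaLimitSet_iff.1 hy (ε / 2) (half_pos hε) (t + J)
    have hreach := reach_traj hx t (m - t)
    rw [show t + (m - t) = m by omega] at hreach
    obtain ⟨z, hz, hmz⟩ := hJ (m - t) (by omega) _ _ hti htc hreach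
    refine ⟨z, hz, ?_⟩
    have := abs_sub_le y (P.traj x m) z
    rw [abs_sub_comm y (P.traj x m)] at this
    linarith
  · intro y hy
    exact mem_omegaLimitSet_iff.2 (cluster_of_mem_omega hs
      (branch_mem_Xtilde hD h.1 h.mem_closure) (h.cluster_branch hs) hy)

theorem exists_mem_omega_of_backward (hmono : P.PiecewiseMonotonic) (hD : P.D ⊆ P.Xtilde)
    {y : ℕ → ℝ} (hX : ∀ n, y n ∈ P.X) (hy : ∀ n, P.Step (y (n + 1)) (y n)) :
    ∃ x ∈ P.Xtilde, y 0 ∈ P.omegaLimitSet x := by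
  obtain ⟨hback, hs⟩ := shifting_of_backward hy
  have hback' : ∀ m, P.Reach m (y m) (y 0) := fun m => by simpa using hback m 0
  by_cases hA : ∃ c i, P.Accumulates y c i
  · obtain ⟨c, i, hA⟩ := hA
    refine ⟨P.branch i c, branch_mem_Xtilde hD hA.1 hA.mem_closure, ?_⟩
    obtain ⟨c', i', hA', r, hr, hattr⟩ := attracting_accumulates hmono hD hs hX hA
    refine mem_of_isClosed_of_close (isClosed_omega _) fun ε hε => ?_
    obtain ⟨J, hJ⟩ := hattr ε hε
    obtain ⟨m, hm, hmi, hmc⟩ := hA'.2 r hr J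
    exact hJ m hm _ _ hmi hmc (hback' m)
  push Not at hA
  have htail : ∃ n₀, ∀ n ≥ n₀, y n ∈ P.Xstar := by
    by_contra! hcon
    obtain ⟨m, -, hm⟩ := hcon 0
    obtain ⟨n, hn, hn'⟩ := hcon (m + 1)
    obtain ⟨k, rfl⟩ : ∃ k, n = m + k + 1 := ⟨n - m - 1, by omega⟩
    obtain ⟨i, hi, hbr⟩ := hy (m + k)
    have hd : y (m + k) ∈ P.Xtilde := hbr ▸ branch_mem_Xtilde hD ⟨hX _, hn'⟩ hi
    have hdown : ∀ j ≤ k, y (m + k - j) ∈ P.Xtilde := by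
      intro j
      induction j with
      | zero => exact fun _ => hd
      | succ j ih =>
        intro hj
        have h1 := ih (by omega)
        have h2 := hy (m + k - (j + 1))
        rw [show m + k - (j + 1) + 1 = m + k - j by omega] at h2
        exact h2.eq_of_mem_Xstar (Xtilde_subset_Xstar h1) ▸ apply_mem_Xtilde h1
    have := hdown k le_rfl
    rw [Nat.add_sub_cancel] at this
    exact hm (Xtilde_subset_Xstar this)
  obtain ⟨n₀, hn₀⟩ := htail
  obtain ⟨ρ, hρ, hfar⟩ := exists_far_cluster hs hX hn₀ hA
  obtain ⟨J₀, hJ₀⟩ := exists_cluster_near hX one_pos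
  obtain ⟨w, hw, -⟩ := hJ₀ J₀ le_rfl
  obtain ⟨hwX, hwfar⟩ := hfar w hw
  refine ⟨w, hwX, mem_omegaLimitSet_iff.2 fun ε hε n => ?_⟩
  obtain ⟨J, hJ⟩ := P.exists_pow_mul_lt hε ρ
  obtain ⟨m, hm, hmw⟩ := hw ρ hρ (max J n)
  have h1 := (hback' m).abs_sub_le hwX (fun k _ => hwfar k) hmw
  have h2 := mul_le_mul_of_nonneg_left hmw.le (pow_nonneg P.hlam₀.le m)
  refine ⟨m, (le_max_right _ _).trans hm, ?_⟩
  rw [abs_sub_comm]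
  linarith [hJ m ((le_max_left _ _).trans hm)]

theorem exists_branch_mem_omega {x : ℝ} (hx : x ∈ P.Xtilde) {y : ℝ} (hy : y ∈ P.omegaLimitSet x) :
    ∃ i, y ∈ closure (P.piece i) ∧ P.branch i y ∈ P.omegaLimitSet x := by
  rw [mem_omegaLimitSet_iff] at hy
  obtain ⟨i, hi⟩ : ∃ i, ∃ᶠ n : ℕ in atTop,
      ∃ m ≥ n, P.traj x m ∈ P.piece i ∧ |P.traj x m - y| < 1 / ((n : ℝ) + 1) := by
    by_contra! hcon
    obtain ⟨n, hn⟩ := (eventually_all.2 hcon).exists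
    obtain ⟨m, hm, hmy⟩ := hy _ (Nat.one_div_pos_of_nat (n := n)) n
    obtain ⟨i, hi⟩ := mem_iUnion.1 (traj_mem_Xstar hx m)
    exact (hn i m hm hi).not_gt hmy
  have hfreq : ∀ ε > 0, ∀ n, ∃ m ≥ n, P.traj x m ∈ P.piece i ∧ |P.traj x m - y| < ε := by
    intro ε hε n
    obtain ⟨k, hk⟩ := exists_nat_one_div_lt hε
    obtain ⟨l, hl, m, hm, hmi, hmy⟩ := frequently_atTop.1 hi (max n k)
    refine ⟨m, ((le_max_left n k).trans hl).trans hm, hmi, hmy.trans (lt_of_le_of_lt ?_ hk)⟩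
    exact Nat.one_div_le_one_div ((le_max_right n k).trans hl)
  refine ⟨i, Metric.mem_closure_iff.2 fun ε hε => ?_, mem_omegaLimitSet_iff.2 fun ε hε n => ?_⟩
  · obtain ⟨m, -, hmi, hmy⟩ := hfreq ε hε 0
    exact ⟨_, hmi, by rwa [dist_comm, Real.dist_eq]⟩
  · obtain ⟨m, hm, hmi, hmy⟩ := hfreq ε hε n
    refine ⟨m + 1, hm.trans (Nat.le_succ m), ?_⟩
    rw [traj_succ, ← P.branch_eq hmi]
    exact (P.abs_branch_sub_le _ _ _).trans_lt
      ((mul_le_of_le_one_left (abs_nonneg _) P.hlam₁.le).trans_lt hmy)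

theorem pseudoInvariant_omega {x : ℝ} (hx : x ∈ P.Xtilde) :
    P.PseudoInvariant (P.omegaLimitSet x) := by
  intro y hy
  obtain ⟨i, hi, hb⟩ := exists_branch_mem_omega hx hy
  exact (P.branch_isOneSidedLimit hi).imp (fun h => ⟨_, hb, h⟩) fun h => ⟨_, hb, h⟩

theorem Accumulates.exists_of_mem_omega {x : ℝ} (hx : x ∈ P.Xtilde) {c : ℝ} {i : Fin P.N}
    (h : P.Accumulates (P.traj x) c i) {y : ℝ} (hy : y ∈ P.omegaLimitSet x)
    (hyX : y ∈ P.Xtilde) : ∃ c' i', P.Accumulates (P.traj y) c' i' := by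
  by_contra! hcon
  obtain ⟨ρ, hρ, hfar⟩ := exists_far_of_forall_not_accumulates (traj_mem_Xstar hyX) hcon
  obtain ⟨m, -, hm⟩ := mem_omegaLimitSet_iff.1 hy (ρ / 2) (half_pos hρ) 0
  obtain ⟨n, hn, -, hnc⟩ := h.2 (ρ / 2) (half_pos hρ) m
  obtain ⟨k, rfl⟩ := Nat.exists_eq_add_of_le hn
  have h1 := (reach_traj hx m k).abs_sub_le hyX (fun k _ => hfar k) (hm.trans (half_lt_self hρ))
  have h2 := mul_le_of_le_one_left (abs_nonneg (P.traj x m - y))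
    (pow_le_one₀ (n := k) P.hlam₀.le P.hlam₁.le)
  have h3 := abs_sub_le (P.traj y k) (P.traj x (m + k)) c
  rw [abs_sub_comm (P.traj y k) (P.traj x (m + k))] at h3
  linarith [hfar k c h.1]

theorem Accumulates.omega_eq_of_mem_omega (hmono : P.PiecewiseMonotonic) (hD : P.D ⊆ P.Xtilde)
    {x : ℝ} (hx : x ∈ P.Xtilde) {c : ℝ} {i : Fin P.N} (h : P.Accumulates (P.traj x) c i) {y : ℝ}
    (hy : y ∈ P.omegaLimitSet x) (hyX : y ∈ P.Xtilde) :
    P.omegaLimitSet y = P.omegaLimitSet x := by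
  obtain ⟨c', i', hA⟩ := h.exists_of_mem_omega hx hy hyX
  have hA' := accumulates_of_cluster (traj_mem_X hx)
    (cluster_traj (shifting_traj hx) hyX (mem_omegaLimitSet_iff.1 hy)) hA
  rw [hA.omega_eq hmono hD hyX, hA'.omega_eq hmono hD hx]

theorem Accumulates.xtildeMinimal_omega (hmono : P.PiecewiseMonotonic) (hD : P.D ⊆ P.Xtilde)
    {x : ℝ} (hx : x ∈ P.Xtilde) {c : ℝ} {i : Fin P.N} (h : P.Accumulates (P.traj x) c i) :
    P.XtildeMinimal (P.omegaLimitSet x) := by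
  refine ⟨isCompact_omega hx, pseudoInvariant_omega hx, fun y hy z hz => ?_⟩
  rw [← h.omega_eq_of_mem_omega hmono hD hx hy.1 hy.2] at hz
  exact mem_closure_orbit_of_mem_omega hz

theorem traj_mem_omega_of_mem_omega {x : ℝ} (hx : x ∈ P.Xtilde) (h : x ∈ P.omegaLimitSet x)
    (n : ℕ) : P.traj x n ∈ P.omegaLimitSet x :=
  mem_omegaLimitSet_iff.2 (cluster_traj (shifting_traj hx) hx (mem_omegaLimitSet_iff.1 h) n)

theorem Accumulates.mem_omega {x c : ℝ} {i : Fin P.N} (h : P.Accumulates (P.traj x) c i) :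
    c ∈ P.omegaLimitSet x :=
  mem_omegaLimitSet_iff.2 fun ε hε n => by
    obtain ⟨m, hm, -, hmc⟩ := h.2 ε hε n
    exact ⟨m, hm, hmc⟩

theorem Accumulates.perfect_omega {d c : ℝ} {i : Fin P.N} (hd : d ∈ P.Xtilde)
    (hdd : d ∈ P.omegaLimitSet d) (h : P.Accumulates (P.traj d) c i) :
    Perfect (P.omegaLimitSet d) := by
  refine ⟨isClosed_omega d, fun y hy => ?_⟩
  rw [accPt_iff_nhds]
  by_contra! hcon
  obtain ⟨U, hU, hUy⟩ := hcon
  obtain ⟨ε, hε, hball⟩ := Metric.mem_nhds_iff.1 hU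
  have hy' := mem_omegaLimitSet_iff.1 hy
  have heq : ∀ n, |P.traj d n - y| < ε → P.traj d n = y := fun n hn =>
    hUy _ ⟨hball (by rwa [mem_ball, Real.dist_eq]), traj_mem_omega_of_mem_omega hd hdd n⟩
  obtain ⟨m, -, hm⟩ := hy' ε hε 0
  obtain ⟨n, hn, hny⟩ := hy' ε hε (m + 1)
  obtain ⟨k, rfl⟩ := Nat.exists_eq_add_of_le hn
  have h1 := heq m hm
  have hper : P.f^[1 + k] y = y := by
    have h2 := heq _ hny
    rwa [add_assoc, ← traj_traj, h1] at h2
  have hyX : y ∈ P.Xtilde := h1 ▸ traj_mem_Xtilde hd m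
  have hω := h.mem_omega
  rw [← omega_traj d m, h1, omega_eq_orbit_of_periodic (Nat.le_add_right 1 k) hper] at hω
  exact h.1.2 (Xtilde_subset_Xstar (orbit_subset_Xtilde hyX hω))

theorem omega_subset_iUnion_image_branch {d : ℝ} (hd : d ∈ P.Xtilde)
    (hdd : d ∈ P.omegaLimitSet d) :
    P.omegaLimitSet d ⊆ ⋃ i, P.branch i '' (P.omegaLimitSet d ∩ closure (P.piece i)) := by
  have hcl : IsClosed (⋃ i, P.branch i '' (P.omegaLimitSet d ∩ closure (P.piece i))) :=
    isClosed_iUnion_of_finite fun i =>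
      (((isCompact_omega hd).inter_right isClosed_closure).image
        (P.branch_lipschitz i).continuous).isClosed
  intro y hy
  refine closure_minimal ?_ hcl (mem_iInter.1 hy 1)
  rintro _ ⟨m, hm, rfl⟩
  obtain ⟨k, rfl⟩ := Nat.exists_eq_add_of_le' hm
  obtain ⟨i, hi⟩ := mem_iUnion.1 (traj_mem_Xstar hd k)
  refine mem_iUnion.2 ⟨i, _, ⟨traj_mem_omega_of_mem_omega hd hdd k, subset_closure hi⟩, ?_⟩
  rw [P.branch_eq hi]
  exact (traj_succ d k).symm

theorem measurableSet_piece (i : Fin P.N) : MeasurableSet (P.piece i) := by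
  obtain ⟨c, d, h⟩ := P.piece_interval i
  exact h ▸ measurableSet_Ioo.inter measurableSet_Icc

open MeasureTheory in
theorem volume_image_branch_le (i : Fin P.N) (A : Set ℝ) :
    volume (P.branch i '' A) ≤ ENNReal.ofReal P.lam * volume A := by
  have h := (P.branch_lipschitz i).hausdorffMeasure_image_le zero_le_one A
  rwa [hausdorffMeasure_real, ENNReal.rpow_one] at h

open MeasureTheory in
theorem volume_inter_closure_piece_le (i : Fin P.N) (A : Set ℝ) :
    volume (A ∩ closure (P.piece i)) ≤ volume (A ∩ P.piece i) := by
  have hsub : A ∩ closure (P.piece i) ⊆ (A ∩ P.piece i) ∪ P.Delta := by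
    rintro y ⟨hy, hyi⟩
    by_cases h : y ∈ P.piece i
    · exact Or.inl ⟨hy, h⟩
    · exact Or.inr (P.mem_Delta_of_mem_closure hyi h)
  calc volume (A ∩ closure (P.piece i)) ≤ volume (A ∩ P.piece i) + volume P.Delta :=
        (measure_mono hsub).trans (measure_union_le _ _)
    _ = volume (A ∩ P.piece i) := by rw [P.finite_Delta.measure_zero, add_zero]

open MeasureTheory in
theorem volume_omega_eq_zero {d : ℝ} (hd : d ∈ P.Xtilde) (hdd : d ∈ P.omegaLimitSet d) :
    volume (P.omegaLimitSet d) = 0 := by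
  set A := P.omegaLimitSet d with hA
  have hmeas : MeasurableSet A := (isClosed_omega d).measurableSet
  have hsum : ∑ i, volume (A ∩ P.piece i) ≤ volume A := by
    rw [← tsum_fintype (L := .unconditional _), ← measure_iUnion]
    · exact measure_mono (iUnion_subset fun i => inter_subset_left)
    · exact fun i j hij => (P.piece_disjoint i j hij).mono inter_subset_right inter_subset_right
    · exact fun i => hmeas.inter (measurableSet_piece i)
  have hle : volume A ≤ ENNReal.ofReal P.lam * volume A :=
    calc volume A ≤ volume (⋃ i, P.branch i '' (A ∩ closure (P.piece i))) :=
          measure_mono (omega_subset_iUnion_image_branch hd hdd)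
      _ ≤ ∑ i, volume (P.branch i '' (A ∩ closure (P.piece i))) := measure_iUnion_fintype_le _ _
      _ ≤ ∑ i, ENNReal.ofReal P.lam * volume (A ∩ P.piece i) :=
          Finset.sum_le_sum fun i _ => (volume_image_branch_le i _).trans
            (mul_le_mul_right (volume_inter_closure_piece_le i A) _)
      _ = ENNReal.ofReal P.lam * ∑ i, volume (A ∩ P.piece i) := by rw [Finset.mul_sum]
      _ ≤ ENNReal.ofReal P.lam * volume A := mul_le_mul_right hsum _
  by_contra h0
  have hfin : volume A ≠ ⊤ := (isCompact_omega hd).measure_lt_top.ne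
  have hlt := ENNReal.mul_lt_mul_left h0 hfin (ENNReal.ofReal_lt_one.2 P.hlam₁)
  rw [one_mul] at hlt
  exact absurd hle hlt.not_ge

theorem _root_.Real.isTotallyDisconnected_of_volume_eq_zero {A : Set ℝ}
    (hA : MeasureTheory.volume A = 0) : IsTotallyDisconnected A := by
  intro t htA ht
  by_contra hcon
  obtain ⟨x, hx, y, hy, hxy⟩ := (not_subsingleton_iff.1 hcon).exists_lt
  have h1 : MeasureTheory.volume (Icc x y) = 0 :=
    MeasureTheory.measure_mono_null ((ht.Icc_subset hx hy).trans htA) hA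
  rw [Real.volume_Icc, ENNReal.ofReal_eq_zero] at h1
  linarith

theorem Accumulates.isCantorSet_omega (hmono : P.PiecewiseMonotonic) (hD : P.D ⊆ P.Xtilde)
    {x : ℝ} (hx : x ∈ P.Xtilde) {c : ℝ} {i : Fin P.N} (h : P.Accumulates (P.traj x) c i) :
    IsCantorSet (P.omegaLimitSet x) := by
  have hd := branch_mem_Xtilde hD h.1 h.mem_closure
  have hdx : P.branch i c ∈ P.omegaLimitSet x :=
    mem_omegaLimitSet_iff.2 (h.cluster_branch (shifting_traj hx))
  have heq := h.omega_eq hmono hD hx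
  obtain ⟨c', i', hA⟩ := h.exists_of_mem_omega hx hdx hd
  rw [heq] at hdx ⊢
  exact ⟨omega_nonempty hd, isCompact_omega hd, hA.perfect_omega hd hdx,
    Real.isTotallyDisconnected_of_volume_eq_zero (volume_omega_eq_zero hd hdx)⟩

theorem isPeriodicOrbit_omega_or_exists_accumulates {x : ℝ} (hx : x ∈ P.Xtilde) :
    P.IsPeriodicOrbit (P.omegaLimitSet x) ∨ ∃ c i, P.Accumulates (P.traj x) c i := by
  by_cases h : ∃ c i, P.Accumulates (P.traj x) c i
  · exact Or.inr h
  push Not at h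
  obtain ⟨z, hz, q, hq, hper, heq⟩ := exists_periodic_of_not_accumulates hx h
  exact Or.inl ⟨z, hz, q, hq, hper, heq⟩

theorem IsPeriodicOrbit.subset_Xtilde {A : Set ℝ} (h : P.IsPeriodicOrbit A) : A ⊆ P.Xtilde := by
  obtain ⟨z, hz, -, -, -, rfl⟩ := h
  exact orbit_subset_Xtilde hz

theorem IsPeriodicOrbit.omega_eq {A : Set ℝ} (h : P.IsPeriodicOrbit A) {x : ℝ} (hx : x ∈ A) :
    P.omegaLimitSet x = A := by
  obtain ⟨z, -, q, hq, hper, rfl⟩ := h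
  obtain ⟨k, rfl⟩ := hx
  exact (omega_traj z k).trans (omega_eq_orbit_of_periodic hq hper)

theorem IsPeriodicOrbit.disjoint {A B : Set ℝ} (hA : P.IsPeriodicOrbit A)
    (hB : P.IsPeriodicOrbit B) (hAB : A ≠ B) : Disjoint A B :=
  Set.disjoint_left.2 fun _ hxA hxB => hAB ((hA.omega_eq hxA).symm.trans (hB.omega_eq hxB))

theorem finite_image_omega (hmono : P.PiecewiseMonotonic) (hD : P.D ⊆ P.Xtilde) :
    (P.omegaLimitSet '' P.Xtilde).Finite := by
  rcases P.Delta.eq_empty_or_nonempty with hΔ | hΔ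
  · refine Set.Subsingleton.finite ?_
    rintro _ ⟨x, hx, rfl⟩ _ ⟨y, hy, rfl⟩
    refine omega_eq_of_close (ρ := |x - y| + 1) (a := 0) hx hy (fun k c hc => ?_) (lt_add_one _)
    rw [hΔ] at hc
    exact hc.elim
  · refine ((P.finite_Delta.prod (finite_univ (α := Fin P.N))).image
      fun p => P.omegaLimitSet (P.branch p.2 p.1)).subset ?_
    rintro _ ⟨x, hx, rfl⟩
    by_cases h : ∃ c i, P.Accumulates (P.traj x) c i
    · obtain ⟨c, i, h⟩ := h
      exact ⟨(c, i), ⟨h.1, mem_univ i⟩, (h.omega_eq hmono hD hx).symm⟩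
    · push Not at h
      obtain ⟨c, hc, i, -, heq⟩ := exists_omega_eq_of_not_accumulates hD hΔ hx h
      exact ⟨(c, i), ⟨hc, mem_univ i⟩, heq.symm⟩

theorem Xtilde_nonempty (hD : P.D ⊆ P.Xtilde) : P.Xtilde.Nonempty := by
  rcases P.Delta.eq_empty_or_nonempty with hΔ | ⟨c, hc⟩
  · have hX : P.X ⊆ P.Xstar := sdiff_eq_empty.1 hΔ
    exact ⟨P.a, mem_iInter.2 fun k => hX (P.mapsTo.iterate k (left_mem_Icc.2 P.hab.le))⟩
  · obtain ⟨i, hi⟩ := P.exists_mem_closure_piece hc.1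
    exact ⟨_, branch_mem_Xtilde hD hc hi⟩

theorem isClosed_LambdaIter (n : ℕ) : IsClosed (P.LambdaIter n) := by
  cases n with
  | zero => exact isClosed_Icc
  | succ n => exact isClosed_closure

theorem antitone_LambdaIter : Antitone P.LambdaIter := by
  refine antitone_nat_of_succ_le fun n => ?_
  induction n with
  | zero =>
    refine closure_minimal ?_ isClosed_Icc
    rintro _ ⟨w, hw, rfl⟩
    exact P.mapsTo hw.1
  | succ n ih => exact closure_mono (image_mono (sdiff_le_sdiff_right ih))

theorem LambdaIter_subset_X (n : ℕ) : P.LambdaIter n ⊆ P.X := antitone_LambdaIter (Nat.zero_le n)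

theorem traj_mem_LambdaIter {x : ℝ} (hx : x ∈ P.Xtilde) (n k : ℕ) :
    P.traj x (n + k) ∈ P.LambdaIter n := by
  induction n with
  | zero => exact traj_mem_X hx _
  | succ n ih =>
    rw [show n + 1 + k = n + k + 1 by omega, traj_succ]
    exact subset_closure ⟨_, ⟨ih, fun h => h.2 (traj_mem_Xstar hx _)⟩, rfl⟩

theorem omega_subset_Lambda {x : ℝ} (hx : x ∈ P.Xtilde) : P.omegaLimitSet x ⊆ P.Lambda := by
  intro y hy
  refine mem_iInter.2 fun n => ?_
  refine closure_minimal ?_ (isClosed_LambdaIter (n + 1)) (mem_iInter.1 hy (n + 1))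
  rintro _ ⟨m, hm, rfl⟩
  obtain ⟨k, rfl⟩ := Nat.exists_eq_add_of_le hm
  exact traj_mem_LambdaIter hx (n + 1) k

theorem Lambda_subset_X : P.Lambda ⊆ P.X := fun _ hy => LambdaIter_subset_X 1 (mem_iInter.1 hy 0)

theorem exists_step_of_mem_LambdaIter_succ {n : ℕ} {y : ℝ} (hy : y ∈ P.LambdaIter (n + 1)) :
    ∃ i, ∃ w ∈ P.LambdaIter n, w ∈ closure (P.piece i) ∧ P.branch i w = y := by
  have hcl : IsClosed (⋃ i, P.branch i '' (P.LambdaIter n ∩ closure (P.piece i))) :=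
    isClosed_iUnion_of_finite fun i =>
      (((isCompact_Icc.of_isClosed_subset (isClosed_LambdaIter n)
        (LambdaIter_subset_X n)).inter_right isClosed_closure).image
        (P.branch_lipschitz i).continuous).isClosed
  have hsub : P.LambdaIter (n + 1) ⊆
      ⋃ i, P.branch i '' (P.LambdaIter n ∩ closure (P.piece i)) := by
    refine closure_minimal ?_ hcl
    rintro _ ⟨w, hw, rfl⟩
    have hws : w ∈ P.Xstar := by
      by_contra h
      exact hw.2 ⟨LambdaIter_subset_X n hw.1, h⟩
    obtain ⟨i, hi⟩ := mem_iUnion.1 hws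
    exact mem_iUnion.2 ⟨i, w, ⟨hw.1, subset_closure hi⟩, P.branch_eq hi⟩
  obtain ⟨i, w, hw, rfl⟩ := mem_iUnion.1 (hsub hy)
  exact ⟨i, w, hw.1, hw.2, rfl⟩

theorem exists_step_of_mem_Lambda {y : ℝ} (hy : y ∈ P.Lambda) : ∃ w ∈ P.Lambda, P.Step w y := by
  let W : ℕ → Set ℝ := fun n =>
    ⋃ i, P.LambdaIter (n + 1) ∩ (closure (P.piece i) ∩ P.branch i ⁻¹' {y})
  have hcl : ∀ n, IsClosed (W n) := fun n => isClosed_iUnion_of_finite fun i =>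
    (isClosed_LambdaIter (n + 1)).inter
      (isClosed_closure.inter (isClosed_singleton.preimage (P.branch_lipschitz i).continuous))
  have hW : (⋂ n, W n).Nonempty := by
    refine IsCompact.nonempty_iInter_of_sequence_nonempty_isCompact_isClosed W
      (fun n => ?_) (fun n => ?_) ?_ hcl
    · exact iUnion_mono fun i => inter_subset_inter_left _ (antitone_LambdaIter (Nat.le_succ _))
    · obtain ⟨i, w, hw, hwi, hb⟩ := exists_step_of_mem_LambdaIter_succ (mem_iInter.1 hy (n + 1))
      exact ⟨w, mem_iUnion.2 ⟨i, hw, hwi, hb⟩⟩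
    · refine isCompact_Icc.of_isClosed_subset (hcl 0) (?_ : W 0 ⊆ P.X)
      exact iUnion_subset fun i => inter_subset_left.trans (LambdaIter_subset_X 1)
  obtain ⟨w, hw⟩ := hW
  refine ⟨w, mem_iInter.2 fun n => ?_, ?_⟩
  · obtain ⟨i, h, -⟩ := mem_iUnion.1 (mem_iInter.1 hw n)
    exact h
  · obtain ⟨i, -, hwi, hb⟩ := mem_iUnion.1 (mem_iInter.1 hw 0)
    exact ⟨i, hwi, hb⟩

theorem Lambda_eq_iUnion_omega (hmono : P.PiecewiseMonotonic) (hD : P.D ⊆ P.Xtilde) :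
    P.Lambda = ⋃ x ∈ P.Xtilde, P.omegaLimitSet x := by
  refine Subset.antisymm (fun y hy => ?_) (iUnion₂_subset fun x hx => omega_subset_Lambda hx)
  choose! g hg hstep using fun z (hz : z ∈ P.Lambda) => exists_step_of_mem_Lambda hz
  have hmem : ∀ n, g^[n] y ∈ P.Lambda := fun n => MapsTo.iterate hg n hy
  obtain ⟨x, hx, hyx⟩ := exists_mem_omega_of_backward hmono hD (y := fun n => g^[n] y)
    (fun n => Lambda_subset_X (hmem n)) fun n => by
      rw [Function.iterate_succ_apply']
      exact hstep _ (hmem n)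
  exact mem_iUnion₂.2 ⟨x, hx, hyx⟩

end PCIM

/-- Structure of the attractor (Calderón–Catsigeras–Guiraud):
if `f` is piecewise monotonic and `D ⊆ X̃`, the attractor `Λ` decomposes into
finitely many periodic orbits contained in `X̃` and finitely many pseudo-invariant
`X̃`-minimal Cantor sets, and the ω-limit set of every point of `X̃` is one of them. -/
theorem attractor_decomposition (P : PCIM)
    (hmono : P.PiecewiseMonotonic) (hD : P.D ⊆ P.Xtilde) :
    ∃ (N₁ N₂ : ℕ), 1 ≤ N₁ + N₂ ∧
      ∃ (O : Fin N₁ → Set ℝ) (K : Fin N₂ → Set ℝ),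
        P.Lambda = (⋃ i, O i) ∪ (⋃ j, K j) ∧
        (∀ i, O i ⊆ P.Xtilde ∧ P.IsPeriodicOrbit (O i)) ∧
        (∀ i i', i ≠ i' → Disjoint (O i) (O i')) ∧
        (∀ j, P.PseudoInvariant (K j) ∧ P.XtildeMinimal (K j) ∧
          K j ⊆ P.X ∧ IsCantorSet (K j)) ∧
        (∀ j j', j ≠ j' → K j ≠ K j') ∧
        (∀ x ∈ P.Xtilde,
          (∃ i, P.omegaLimitSet x = O i) ∨ (∃ j, P.omegaLimitSet x = K j)) := by
  have hfin := PCIM.finite_image_omega hmono hD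
  set W := P.omegaLimitSet '' P.Xtilde with hW
  have hfin₁ : Finite {A ∈ W | P.IsPeriodicOrbit A} := hfin.subset (sep_subset _ _)
  have hfin₂ : Finite {A ∈ W | ¬ P.IsPeriodicOrbit A} := hfin.subset (sep_subset _ _)
  obtain ⟨N₁, ⟨e₁⟩⟩ := Finite.exists_equiv_fin {A ∈ W | P.IsPeriodicOrbit A}
  obtain ⟨N₂, ⟨e₂⟩⟩ := Finite.exists_equiv_fin {A ∈ W | ¬ P.IsPeriodicOrbit A}
  have hclass : ∀ x ∈ P.Xtilde, (∃ i, P.omegaLimitSet x = (e₁.symm i : Set ℝ)) ∨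
      ∃ j, P.omegaLimitSet x = (e₂.symm j : Set ℝ) := by
    intro x hx
    have hxW : P.omegaLimitSet x ∈ W := mem_image_of_mem _ hx
    by_cases h : P.IsPeriodicOrbit (P.omegaLimitSet x)
    · exact Or.inl ⟨e₁ ⟨_, hxW, h⟩, by rw [Equiv.symm_apply_apply]⟩
    · exact Or.inr ⟨e₂ ⟨_, hxW, h⟩, by rw [Equiv.symm_apply_apply]⟩
  have hsub : ∀ A ∈ W, A ⊆ P.Lambda := by
    rintro _ ⟨x, hx, rfl⟩
    exact PCIM.omega_subset_Lambda hx
  refine ⟨N₁, N₂, ?_, fun i => e₁.symm i, fun j => e₂.symm j, ?_, ?_, ?_, ?_, ?_, hclass⟩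
  · obtain ⟨x, hx⟩ := PCIM.Xtilde_nonempty hD
    rcases hclass x hx with ⟨i, -⟩ | ⟨j, -⟩
    · have := i.pos
      omega
    · have := j.pos
      omega
  · refine Subset.antisymm (fun y hy => ?_) (union_subset
      (iUnion_subset fun i => hsub _ (e₁.symm i).2.1)
      (iUnion_subset fun j => hsub _ (e₂.symm j).2.1))
    rw [PCIM.Lambda_eq_iUnion_omega hmono hD] at hy
    obtain ⟨x, hx, hy⟩ := mem_iUnion₂.1 hy
    rcases hclass x hx with ⟨i, hi⟩ | ⟨j, hj⟩
    · exact Or.inl (mem_iUnion.2 ⟨i, hi ▸ hy⟩)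
    · exact Or.inr (mem_iUnion.2 ⟨j, hj ▸ hy⟩)
  · exact fun i => ⟨(e₁.symm i).2.2.subset_Xtilde, (e₁.symm i).2.2⟩
  · exact fun i i' hii' => (e₁.symm i).2.2.disjoint (e₁.symm i').2.2
      fun h => hii' (e₁.symm.injective (Subtype.ext h))
  · intro j
    obtain ⟨⟨x, hx, hxj⟩, hnot⟩ := (e₂.symm j).2
    beta_reduce
    rw [← hxj] at hnot ⊢
    obtain ⟨c, i, hA⟩ := (PCIM.isPeriodicOrbit_omega_or_exists_accumulates hx).resolve_left hnot
    exact ⟨PCIM.pseudoInvariant_omega hx, hA.xtildeMinimal_omega hmono hD hx,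
      PCIM.omega_subset_X hx, hA.isCantorSet_omega hmono hD hx⟩
  · exact fun j j' hjj' h => hjj' (e₂.symm.injective (Subtype.ext h))
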